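/- arXiv:2009.03875 — 3 statements merged into one kernel-verified Lean document; each statement's English description precedes it below -/
import Mathlib

section
/- Let p > q be distinct primes. For every nondegenerate interval J̃ ⊆ [0,1] and every ε > 0 there exists a q-adic interval I ⊆ J̃ such that 0 < Υ(J) − Z(I) ≤ ε·|I|, where J is the smallest p-adic interval containing I. -/
open Set

noncomputable section

/-- The `n`-adic interval `[(k-1)/n^m, k/n^m)` with `m, k : ℤ`. -/
def adicInterval (n : ℕ) (m k : ℤ) : Set ℝ :=
  Set.Ico (((k : ℝ) - 1) / (n : ℝ) ^ m) ((k : ℝ) / (n : ℝ) ^ m)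

/-- `Z(I)`: the left endpoint of the rightmost `q`-adic child of the `q`-adic interval with
parameters `m, k`, namely `(k-1)/q^m + (q-1)/q^(m+1)`. -/
def Zpt (q : ℕ) (m k : ℤ) : ℝ :=
  ((k : ℝ) - 1) / (q : ℝ) ^ m + ((q : ℝ) - 1) / (q : ℝ) ^ (m + 1)

/-- `Υ(J)`: the right endpoint of the leftmost `p`-adic child of the `p`-adic interval with
parameters `m, k`, namely `(k-1)/p^m + 1/p^(m+1)`. -/
def Upt (p : ℕ) (m k : ℤ) : ℝ :=
  ((k : ℝ) - 1) / (p : ℝ) ^ m + 1 / (p : ℝ) ^ (m + 1)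

/-- The `p`-adic interval with parameters `m, k` is the smallest `p`-adic interval
containing the set `s`. -/
def IsSmallestAdicContaining (p : ℕ) (m k : ℤ) (s : Set ℝ) : Prop :=
  s ⊆ adicInterval p m k ∧
  ∀ m' k' : ℤ, s ⊆ adicInterval p m' k' → adicInterval p m k ⊆ adicInterval p m' k'

lemma exists_nat_solve (p : ℕ) (hp : p.Prime) (B e : ℤ) (hB : ¬ (p : ℤ) ∣ B) :
    ∃ i : ℕ, (p : ℤ) ∣ e + B * i := by
  have hpz : Prime (p : ℤ) := Nat.prime_iff_prime_int.mp hp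
  obtain ⟨α, β, h⟩ := (hpz.coprime_iff_not_dvd).2 hB
  have hp0 : (p : ℤ) ≠ 0 := by exact_mod_cast hp.ne_zero
  refine ⟨((-e * β) % p).toNat, ?_⟩
  rw [Int.toNat_of_nonneg (Int.emod_nonneg _ hp0)]
  have h2 := Int.emod_add_mul_ediv (-e * β) p
  refine ⟨e * α - B * ((-e * β) / p), ?_⟩
  linear_combination B * h2 - e * h

lemma exists_pow_congr (p : ℕ) (hp : p.Prime) (hp3 : 3 ≤ p) (s : ℕ) (hs : 1 ≤ s) (g u : ℤ)
    (hg : g = 1 + (p : ℤ) ^ s * u) (hu : ¬ (p : ℤ) ∣ u) (a c : ℤ) (ha : ¬ (p : ℤ) ∣ a)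
    (hac : (p : ℤ) ^ s ∣ a - c) (T j : ℕ) :
    ∃ t : ℕ, T ≤ t ∧ (p : ℤ) ^ (s + j) ∣ a * g ^ t - c := by
  have hpz : Prime (p : ℤ) := Nat.prime_iff_prime_int.mp hp
  have hpg : ¬ (p : ℤ) ∣ g := by
    intro h
    rw [hg] at h
    have h1 : (p : ℤ) ∣ (p : ℤ) ^ s * u := Dvd.dvd.mul_right (dvd_pow_self _ (by omega)) _
    exact hpz.not_dvd_one ((dvd_add_left h1).1 h)
  induction j with
  | zero =>
    refine ⟨T, le_rfl, ?_⟩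
    have h1 : (p : ℤ) ^ s ∣ g ^ T - 1 := by
      have h := sub_dvd_pow_sub_pow g 1 T
      rw [one_pow] at h
      refine dvd_trans ⟨u, ?_⟩ h
      rw [hg]; ring
    have : a * g ^ T - c = a * (g ^ T - 1) + (a - c) := by ring
    rw [add_zero, this]
    exact dvd_add (Dvd.dvd.mul_left h1 _) hac
  | succ j ih =>
    obtain ⟨t, ht, e, he⟩ := ih
    obtain ⟨y, hy⟩ := ZMod.exists_one_add_mul_pow_prime_pow_eq (R := ℤ) (u := (p : ℤ) ^ s)
      (v := (p : ℤ)) hp (dvd_pow_self _ (by omega)) (by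
        rw [← pow_mul]
        have : (p : ℤ) * (p : ℤ) ^ s * p = (p : ℤ) ^ (s + 2) := by ring
        rw [this]
        apply pow_dvd_pow
        nlinarith) u j
    rw [← hg] at hy
    have hw : ¬ (p : ℤ) ∣ u + p * y := by
      intro h
      exact hu ((dvd_add_left (Dvd.intro _ rfl)).1 h)
    set w := u + p * y with hwdef
    have hB : ¬ (p : ℤ) ∣ a * g ^ t * w := by
      intro h
      rcases hpz.dvd_or_dvd h with h | h
      · rcases hpz.dvd_or_dvd h with h | h
        · exact ha h
        · exact hpg (hpz.dvd_of_dvd_pow h)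
      · exact hw h
    obtain ⟨i, d, hd⟩ := exists_nat_solve p hp _ e hB
    refine ⟨t + p ^ j * i, by omega, ?_⟩
    have h2 := sq_dvd_add_pow_sub_sub ((p : ℤ) ^ (s + j) * w) 1 i
    obtain ⟨f, hf⟩ := h2
    simp only [one_pow, one_mul] at hf
    have h3 : g ^ (p ^ j * i) = (1 + (p : ℤ) ^ (s + j) * w) ^ i := by
      rw [pow_mul, hy]; congr 1; ring
    obtain ⟨s', rfl⟩ : ∃ s', s = s' + 1 := ⟨s - 1, by omega⟩
    refine ⟨d + a * g ^ t * (p : ℤ) ^ (s' + j) * w ^ 2 * f, ?_⟩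
    rw [pow_add, h3]
    have h4 : (p : ℤ) ^ (s' + 1 + (j + 1)) = (p : ℤ) ^ (s' + 1 + j) * p := by ring
    have h5 : (p : ℤ) * (p : ℤ) ^ (s' + j)  = (p : ℤ) ^ (s' + 1 + j) := by ring
    rw [h4]
    set P := (p : ℤ) ^ (s' + 1 + j)
    linear_combination a * g ^ t * hf + he + P * hd - (P * a * g ^ t * w ^ 2 * f) * h5

lemma adic_nested (p : ℕ) (hp : 2 ≤ p) (m m' k k' : ℤ) (hm : m' ≤ m) (z : ℝ)
    (hz : z ∈ adicInterval p m k) (hz' : z ∈ adicInterval p m' k') :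
    adicInterval p m k ⊆ adicInterval p m' k' := by
  obtain ⟨d, hd⟩ := Int.eq_ofNat_of_zero_le (sub_nonneg.2 hm)
  have hp0 : (0 : ℝ) < p := by positivity
  have hP : (p : ℝ) ^ m = (p : ℝ) ^ m' * ((p ^ d : ℕ) : ℝ) := by
    have : m = m' + (d : ℤ) := by omega
    rw [this, zpow_add₀ hp0.ne', zpow_natCast]; push_cast; ring
  have hm'pos : (0 : ℝ) < (p : ℝ) ^ m' := by positivity
  have hQ : 0 < p ^ d := by positivity
  generalize p ^ d = Q at hP hQ
  have hQr : (0 : ℝ) < Q := by exact_mod_cast hQ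
  simp only [adicInterval, mem_Ico] at hz hz'
  rw [hP] at hz
  have hXp : (0 : ℝ) < (p : ℝ) ^ m' * Q := by positivity
  rw [div_le_iff₀ hXp, lt_div_iff₀ hXp] at hz
  rw [div_le_iff₀ hm'pos, lt_div_iff₀ hm'pos] at hz'
  have h1 : ((k' - 1) * Q : ℤ) < k := by
    have : ((k' : ℝ) - 1) * Q < k := by nlinarith
    exact_mod_cast this
  have h2 : (k - 1 : ℤ) < k' * Q := by
    have : (k : ℝ) - 1 < k' * Q := by nlinarith
    exact_mod_cast this
  have h1' : ((k' : ℝ) - 1) * Q ≤ k - 1 := by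
    have : ((k' - 1) * Q : ℤ) ≤ k - 1 := by omega
    exact_mod_cast this
  have h2' : (k : ℝ) ≤ k' * Q := by
    have : k ≤ k' * Q := by omega
    exact_mod_cast this
  apply Ico_subset_Ico
  · rw [hP, div_le_div_iff₀ hm'pos hXp]; nlinarith
  · rw [hP, div_le_div_iff₀ hXp hm'pos]; nlinarith

/-- The smallest `p`-adic interval criterion. -/
lemma smallest_of (p : ℕ) (hp : 3 ≤ p) (M l : ℤ) (A B : ℝ)
    (hA : A < (p * l + 1) / (p : ℝ) ^ M) (hB : (p * l + 1) / (p : ℝ) ^ M < B)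
    (hlen : B - A ≤ 1 / (p : ℝ) ^ M) :
    IsSmallestAdicContaining p (M - 1) (l + 1) (Ico A B) := by
  have hp0 : (0 : ℝ) < p := by positivity
  have hp3 : (3 : ℝ) ≤ p := by exact_mod_cast hp
  have hR : (0 : ℝ) < (p : ℝ) ^ M := by positivity
  have hM1 : (p : ℝ) ^ (M - 1) = (p : ℝ) ^ M / p := by
    rw [zpow_sub₀ hp0.ne', zpow_one]
  have hsub : Ico A B ⊆ adicInterval p (M - 1) (l + 1) := by
    apply Ico_subset_Ico
    · rw [hM1]; push_cast
      have h : ((l : ℝ) + 1 - 1) / ((p : ℝ) ^ M / p) = (p * l + 1) / (p : ℝ) ^ M - 1 / (p : ℝ) ^ M := by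
        field_simp; ring
      rw [h]; linarith
    · rw [hM1]; push_cast
      have h : ((l : ℝ) + 1) / ((p : ℝ) ^ M / p) =
          (p * l + 1) / (p : ℝ) ^ M + 1 / (p : ℝ) ^ M + (p - 2) / (p : ℝ) ^ M := by
        field_simp; ring
      have h' : 0 ≤ ((p : ℝ) - 2) / (p : ℝ) ^ M := div_nonneg (by linarith) hR.le
      rw [h]; linarith
  refine ⟨hsub, fun m' k' h => ?_⟩
  have hAI : A ∈ Ico A B := ⟨le_rfl, hA.trans hB⟩
  rcases le_or_gt m' (M - 1) with hm | hm
  · exact adic_nested p (by omega) _ _ _ _ hm A (hsub hAI) (h hAI)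
  · exfalso
    have h1 := (h hAI).1
    have h2 := (h (⟨hA.le, hB⟩ : (p * l + 1) / (p : ℝ) ^ M ∈ Ico A B)).2
    obtain ⟨d, hd⟩ := Int.eq_ofNat_of_zero_le (show 0 ≤ m' - M by omega)
    have hP : (p : ℝ) ^ m' = (p : ℝ) ^ M * ((p ^ d : ℕ) : ℝ) := by
      have : m' = M + (d : ℤ) := by omega
      rw [this, zpow_add₀ hp0.ne', zpow_natCast]; push_cast; ring
    have hQ : 0 < p ^ d := by positivity
    generalize p ^ d = Q at hP hQ
    have hQr : (0 : ℝ) < Q := by exact_mod_cast hQ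
    have h3 := h1.trans_lt hA
    rw [hP, div_lt_div_iff₀ (by positivity) hR] at h3
    rw [hP, div_lt_div_iff₀ hR (by positivity)] at h2
    have h4 : (k' : ℝ) - 1 < (p * l + 1) * Q := by
      apply lt_of_mul_lt_mul_right _ hR.le
      linarith
    have h5 : (p * l + 1 : ℝ) * Q < k' := by
      apply lt_of_mul_lt_mul_right _ hR.le
      linarith
    have h4' : k' - 1 < (p * l + 1) * Q := by exact_mod_cast h4
    have h5' : (p * l + 1) * Q < k' := by exact_mod_cast h5
    omega

theorem selection_single_interval (p q : ℕ) (hp : p.Prime) (hq : q.Prime) (hlt : q < p)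
    (Jt : Set ℝ) (hconn : Jt.OrdConnected) (hsub : Jt ⊆ Set.Icc (0 : ℝ) 1)
    (x y : ℝ) (hx : x ∈ Jt) (hy : y ∈ Jt) (hxy : x < y)
    (ε : ℝ) (hε : 0 < ε) :
    ∃ mI kI : ℤ, adicInterval q mI kI ⊆ Jt ∧
      ∃ mJ kJ : ℤ, IsSmallestAdicContaining p mJ kJ (adicInterval q mI kI) ∧
        0 < Upt p mJ kJ - Zpt q mI kI ∧
        Upt p mJ kJ - Zpt q mI kI ≤ ε * (q : ℝ) ^ (-mI) := by
  have hq2 := hq.two_le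
  have hp3 : 3 ≤ p := by omega
  have hp0 : (0 : ℝ) < p := by positivity
  have hq0 : (0 : ℝ) < q := by positivity
  have hp3r : (3 : ℝ) ≤ p := by exact_mod_cast hp3
  have hq2r : (2 : ℝ) ≤ q := by exact_mod_cast hq2
  have hpz : Prime (p : ℤ) := Nat.prime_iff_prime_int.mp hp
  -- the base g
  have hcop : IsCoprime (q : ℤ) (p : ℤ) :=
    Nat.isCoprime_iff_coprime.2 ((Nat.coprime_primes hq hp).2 hlt.ne)
  have hfl : (q : ℤ) ^ (p - 1) ≡ 1 [ZMOD p] := Int.ModEq.pow_card_sub_one_eq_one hp hcop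
  have hg2 : (2 : ℤ) ≤ (q : ℤ) ^ (p - 1) := by
    calc (2 : ℤ) ≤ q := by exact_mod_cast hq2
      _ = (q : ℤ) ^ 1 := (pow_one _).symm
      _ ≤ (q : ℤ) ^ (p - 1) := pow_le_pow_right₀ (by omega) (by omega)
  have hdvd : (p : ℤ) ∣ (q : ℤ) ^ (p - 1) - 1 := hfl.symm.dvd
  have hfin : FiniteMultiplicity (p : ℤ) ((q : ℤ) ^ (p - 1) - 1) :=
    Int.finiteMultiplicity_iff.2 ⟨by simpa using hp.ne_one, by omega⟩
  obtain ⟨u, hgu, hu⟩ := hfin.exists_eq_pow_mul_and_not_dvd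
  generalize hsdef : multiplicity (p : ℤ) ((q : ℤ) ^ (p - 1) - 1) = s at hgu
  have hs : 1 ≤ s := by
    rcases Nat.eq_zero_or_pos s with h | h
    · exfalso
      rw [h, pow_zero, one_mul] at hgu
      exact hu (hgu ▸ hdvd)
    · exact h
  have hg : (q : ℤ) ^ (p - 1) = 1 + (p : ℤ) ^ s * u := by linarith
  -- scales
  set ε' := min ε (1 / (2 * (q : ℝ))) with hε'
  have hε'0 : 0 < ε' := lt_min hε (by positivity)
  have hε'1 : ε' ≤ ε := min_le_left _ _
  have hε'2 : ε' < 1 / q := by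
    refine (min_le_right _ _).trans_lt ?_
    rw [div_lt_div_iff₀ (by positivity) hq0]; linarith
  set δ := (y - x) / 3 with hδ
  have hδ0 : 0 < δ := by rw [hδ]; linarith
  obtain ⟨j, hj⟩ := pow_unbounded_of_one_lt (max (1 / ε') (2 * p / δ)) (show (1 : ℝ) < p by linarith)
  have hj1 : 1 < (p : ℝ) ^ j * ε' := by
    rw [← div_lt_iff₀ hε'0]; exact (le_max_left _ _).trans_lt hj
  have hj2 : 2 * p < (p : ℝ) ^ j * δ := by
    rw [← div_lt_iff₀ hδ0]; exact (le_max_right _ _).trans_lt hj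
  set S : ℝ := (p : ℝ) ^ s with hS
  have hS1 : 1 ≤ S := one_le_pow₀ (by linarith)
  set R : ℝ := (p : ℝ) ^ (s + j) with hR
  have hRS : R = S * (p : ℝ) ^ j := by rw [hR, hS, pow_add]
  have hR0 : 0 < R := by positivity
  have hR1 : S ≤ ε' * R := by rw [hRS]; nlinarith
  have hR2 : 2 * p < R * δ := by rw [hRS]; nlinarith
  -- choose a
  set l : ℤ := ⌊R * (x + δ) / p⌋ + 1 with hl
  have hl1 : R * (x + δ) < p * l := by
    have := Int.lt_floor_add_one (R * (x + δ) / p)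
    rw [div_lt_iff₀ hp0] at this
    rw [hl]; push_cast; linarith
  have hl2 : p * (l : ℝ) ≤ R * (x + δ) + p := by
    have := Int.floor_le (R * (x + δ) / p)
    rw [le_div_iff₀ hp0] at this
    rw [hl]; push_cast; linarith
  have ha : ¬ (p : ℤ) ∣ p * l + 1 := by
    intro h
    exact hpz.not_dvd_one ((dvd_add_right (Dvd.intro _ rfl)).1 h)
  -- choose c
  set w : ℝ := (R * (1 - 1 / q) - (p * l + 1)) / S with hw
  set k : ℤ := ⌊w⌋ + 1 with hk
  have hS0 : 0 < S := by linarith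
  have hc1 : R * (1 - 1 / q) < p * l + 1 + S * k := by
    have := Int.lt_floor_add_one w
    rw [hw, div_lt_iff₀ hS0, ← hw] at this
    rw [hk]; push_cast; linarith
  have hc2 : p * l + 1 + S * k ≤ R * (1 - 1 / q) + S := by
    have := Int.floor_le w
    rw [hw, le_div_iff₀ hS0, ← hw] at this
    rw [hk]; push_cast; linarith
  obtain ⟨t, ht, b, hb⟩ := exists_pow_congr p hp hp3 s hs _ u hg hu (p * l + 1)
    (p * l + 1 + (p : ℤ) ^ s * k) ha ⟨-k, by ring⟩ (p ^ (s + j)) j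
  set c : ℝ := p * l + 1 + S * k with hc
  rw [← pow_mul] at hb
  have hQR : R ≤ (q : ℝ) ^ ((p - 1) * t) := by
    have h1 : p ^ (s + j) ≤ q ^ ((p - 1) * t) := by
      calc p ^ (s + j) ≤ t := ht
        _ ≤ (p - 1) * t := Nat.le_mul_of_pos_left _ (by omega)
        _ ≤ q ^ ((p - 1) * t) := (Nat.lt_pow_self (by omega)).le
    rw [hR]; exact_mod_cast h1
  generalize (p - 1) * t = m at hb hQR
  have hbr : ((p : ℝ) * l + 1) * (q : ℝ) ^ m - c = R * b := by
    have := congrArg (Int.cast : ℤ → ℝ) hb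
    push_cast at this
    rw [hc, hS, hR]; exact this
  set Q : ℝ := (q : ℝ) ^ m with hQ
  have hQ0 : 0 < Q := by positivity
  have hU : ((p : ℝ) * l + 1) / R = (b + c / R) / Q := by
    field_simp; linarith
  have hcR1 : 1 - 1 / q < c / R := by rw [lt_div_iff₀ hR0]; linarith
  have hcR2 : c / R ≤ 1 - 1 / q + ε' := by rw [div_le_iff₀ hR0]; linarith
  have hcR3 : c / R < 1 := by linarith
  have hq1 : 1 / (q : ℝ) ≤ 1 / 2 := by
    rw [div_le_div_iff₀ hq0 (by norm_num)]; linarith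
  have hA : (b : ℝ) / Q < (p * l + 1) / R := by
    rw [hU]; apply div_lt_div_of_pos_right _ hQ0; linarith
  have hB : ((p : ℝ) * l + 1) / R < (b + 1) / Q := by
    rw [hU]; apply div_lt_div_of_pos_right _ hQ0; linarith
  have hlen : (b + 1) / Q - b / Q ≤ 1 / R := by
    have : ((b : ℝ) + 1) / Q - b / Q = 1 / Q := by ring
    rw [this]; exact one_div_le_one_div_of_le hR0 hQR
  have hI : adicInterval q m (b + 1) = Ico ((b : ℝ) / Q) ((b + 1) / Q) := by
    simp [adicInterval, hQ]
  have hRz : R = (p : ℝ) ^ ((s + j : ℕ) : ℤ) := by rw [zpow_natCast]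
  have hUpt : Upt p (((s + j : ℕ) : ℤ) - 1) (l + 1) = ((p : ℝ) * l + 1) / R := by
    rw [Upt, sub_add_cancel, zpow_sub₀ hp0.ne', ← hRz, zpow_one]
    push_cast; field_simp; ring
  have hZ : Zpt q m (b + 1) = (b + (1 - 1 / q)) / Q := by
    rw [Zpt, zpow_add₀ hq0.ne', zpow_natCast, zpow_one, ← hQ]
    push_cast; field_simp; ring
  have hdiff : ((p : ℝ) * l + 1) / R - (b + (1 - 1 / q)) / Q = (c / R - (1 - 1 / q)) / Q := by
    rw [hU]; ring
  refine ⟨m, b + 1, ?_, ((s + j : ℕ) : ℤ) - 1, l + 1, ?_, ?_, ?_⟩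
  · rw [hI]
    have hRδ : 1 / R ≤ δ := by
      rw [div_le_iff₀ hR0]; linarith
    have e1 : x + δ < (p * l + 1) / R := by rw [lt_div_iff₀ hR0]; linarith
    have e2 : (p * l + 1) / R < x + 2 * δ := by rw [div_lt_iff₀ hR0]; linarith
    have e3 : x + 3 * δ = y := by rw [hδ]; ring
    intro z hz
    refine hconn.out hx hy ⟨?_, ?_⟩
    · have := hz.1; linarith
    · have := hz.2; linarith
  · rw [hI]
    apply smallest_of p hp3
    · rw [← hRz]; exact hA
    · rw [← hRz]; exact hB
    · rw [← hRz]; exact hlen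
  · rw [hUpt, hZ, hdiff]
    exact div_pos (by linarith) hQ0
  · rw [hUpt, hZ, hdiff, zpow_neg, zpow_natCast, ← hQ, ← div_eq_mul_inv]
    apply div_le_div_of_nonneg_right _ hQ0.le
    linarith
end
end

section
/- Let p_1, …, p_M be distinct primes with p_1 the smallest. There exist a sequence (I_ℓ)_{ℓ≥1} of p_1-adic subintervals of [0,1) and a sequence (α_ℓ)_{ℓ≥1} of positive integers such that: (1) for each i ∈ {2, …, M}, letting J_i^ℓ denote the smallest p_i-adic interval containing I_ℓ, the intervals (J_i^ℓ)_{ℓ≥1} are pairwise disjoint and contained in [0,1) (in particular the I_ℓ are pairwise disjoint); (2) for each positive integer α there are only finitely many ℓ with α_ℓ = α; (3) for each ℓ ≥ 1 and each i ∈ {2, …, M}, 0 < Υ(J_i^ℓ) − Z(I_ℓ) ≤ p_1^{−100·α_ℓ}·|I_ℓ|. -/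
open Set

noncomputable section

open MeasureTheory in
lemma integral_mFourier {d : Type} [Fintype d] (k : d → ℤ) (hk : k ≠ 0) :
    ∫ x, UnitAddTorus.mFourier k x
      ∂(Measure.pi (fun _ : d => (AddCircle.haarAddCircle : Measure UnitAddCircle))) = 0 := by
  simp only [UnitAddTorus.mFourier, ContinuousMap.coe_mk]
  rw [integral_fintype_prod_eq_prod (fun i : d => fun x : UnitAddCircle => fourier (k i) x)]
  obtain ⟨i, hi⟩ := Function.ne_iff.1 hk
  apply Finset.prod_eq_zero (Finset.mem_univ i)
  exact integral_eq_zero_of_add_right_eq_neg (μ := AddCircle.haarAddCircle)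
      (fourier_add_half_inv_index hi one_pos)

lemma mFourier_line {d : Type} [Fintype d] (k v : d → ℤ) (y : ℝ) :
    UnitAddTorus.mFourier k (fun j => (((v j : ℝ) * y : ℝ) : UnitAddCircle))
      = Complex.exp ((2 * Real.pi * Complex.I * ((∑ j, k j * v j : ℤ) : ℂ)) * y) := by
  simp only [UnitAddTorus.mFourier, ContinuousMap.coe_mk, fourier_coe_apply]
  rw [← Complex.exp_sum]
  congr 1
  push_cast
  rw [Finset.mul_sum, Finset.sum_mul]
  apply Finset.sum_congr rfl
  intro j _
  simp only [div_one]
  ring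

lemma integral_line {d : Type} [Fintype d] (k v : d → ℤ) (h : ∑ j, k j * v j ≠ 0) :
    ∫ y in (0:ℝ)..1, UnitAddTorus.mFourier k (fun j => (((v j : ℝ) * y : ℝ) : UnitAddCircle)) = 0 := by
  simp only [mFourier_line]
  have hne : (2 * Real.pi * Complex.I * ((∑ j, k j * v j : ℤ) : ℂ)) ≠ 0 := by
    have : ((∑ j, k j * v j : ℤ) : ℂ) ≠ 0 := by exact_mod_cast h
    simp only [ne_eq, mul_eq_zero, not_or]
    exact ⟨⟨⟨by norm_num, by exact_mod_cast Real.pi_ne_zero⟩, Complex.I_ne_zero⟩, this⟩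
  rw [integral_exp_mul_complex hne]
  have : Complex.exp (2 * Real.pi * Complex.I * ((∑ j, k j * v j : ℤ) : ℂ) * ((1 : ℝ) : ℂ)) = 1 := by
    rw [Complex.exp_eq_one_iff]
    exact ⟨∑ j, k j * v j, by push_cast; ring⟩
  rw [this]; simp

open MeasureTheory in
lemma kronecker {d : Type} [Fintype d] (x0 : d → ℝ) (r : ℝ) (hr : 0 < r) :
    ∃ F : Finset (d → ℤ), (0 : d → ℤ) ∉ F ∧ ∀ v : d → ℤ,
      (∀ k ∈ F, ∑ j, k j * v j ≠ 0) →
      ∃ y : ℝ, 0 ≤ y ∧ y ≤ 1 ∧ ∀ j, ∃ e : ℤ, |(v j : ℝ) * y - x0 j - e| < r := by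
  classical
  let X0 : UnitAddTorus d := fun j => ((x0 j : ℝ) : UnitAddCircle)
  let g0 : UnitAddTorus d → ℝ := fun x => max 0 (r - dist x X0)
  have hg0c : Continuous g0 := by fun_prop
  let g : C(UnitAddTorus d, ℂ) := ⟨fun x => (g0 x : ℂ), by fun_prop⟩
  let μ : Measure (UnitAddTorus d) :=
    Measure.pi (fun _ : d => (AddCircle.haarAddCircle : Measure UnitAddCircle))
  have : IsProbabilityMeasure μ := by dsimp [μ]; infer_instance
  have : μ.IsOpenPosMeasure := by dsimp [μ]; infer_instance
  have hIntg : ∀ f : C(UnitAddTorus d, ℂ), Integrable f μ := fun f =>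
    f.continuous.integrable_of_hasCompactSupport (HasCompactSupport.of_compactSpace _)
  set δ : ℝ := ∫ x, g0 x ∂μ with hδ
  have hδ0 : 0 < δ := by
    apply hg0c.integral_pos_of_hasCompactSupport_nonneg_nonzero
      (HasCompactSupport.of_compactSpace _) (fun x => le_max_left _ _) (x := X0)
    simp [g0, hr.ne', hr.le]
  have hgδ : ∫ x, g x ∂μ = (δ : ℂ) := by
    simp only [g, ContinuousMap.coe_mk]
    rw [integral_complex_ofReal]
  have hdense : g ∈ (Submodule.span ℂ (range <| UnitAddTorus.mFourier (d := d))).topologicalClosure := by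
    rw [UnitAddTorus.span_mFourier_closure_eq_top]; trivial
  obtain ⟨p, hp, hgp⟩ := Metric.mem_closure_iff.1 hdense (δ / 3) (by positivity)
  obtain ⟨c, hc⟩ := (Finsupp.mem_span_range_iff_exists_finsupp).1 hp
  have hpx : ∀ x, p x = ∑ k ∈ c.support, c k * UnitAddTorus.mFourier k x := by
    intro x
    rw [← hc, Finsupp.sum, ContinuousMap.coe_sum, Finset.sum_apply]
    rfl
  refine ⟨c.support.erase 0, by simp, fun v hv => ?_⟩
  let φ : ℝ → UnitAddTorus d := fun y j => (((v j : ℝ) * y : ℝ) : UnitAddCircle)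
  have hφ : Continuous φ := by
    apply continuous_pi
    intro j
    exact (AddCircle.continuous_mk' 1).comp (by fun_prop)
  have h1 : ∫ x, p x ∂μ = ∑ k ∈ c.support, if k = 0 then c k else 0 := by
    simp only [hpx]
    rw [integral_finsetSum _ (fun k _ => (hIntg _).const_mul _)]
    apply Finset.sum_congr rfl
    intro k _
    rw [integral_const_mul]
    split_ifs with h
    · subst h; simp [UnitAddTorus.mFourier_zero]
    · rw [integral_mFourier k h, mul_zero]
  have h2 : ∫ y in (0:ℝ)..1, p (φ y) = ∑ k ∈ c.support, if k = 0 then c k else 0 := by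
    simp only [hpx]
    rw [intervalIntegral.integral_finsetSum (fun k _ => Continuous.intervalIntegrable (by fun_prop) _ _)]
    apply Finset.sum_congr rfl
    intro k hk
    rw [intervalIntegral.integral_const_mul]
    split_ifs with h
    · subst h; simp [UnitAddTorus.mFourier_zero]
    · rw [integral_line k v (hv k (Finset.mem_erase.2 ⟨h, hk⟩)), mul_zero]
  have hbd : ∀ x, ‖g x - p x‖ ≤ δ / 3 := fun x =>
    ((ContinuousMap.norm_coe_le_norm (g - p) x).trans (by rw [← dist_eq_norm]; exact hgp.le))
  by_contra! hcon
  have hg : ∀ y ∈ Icc (0:ℝ) 1, g (φ y) = 0 := by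
    intro y hy
    obtain ⟨j, hj⟩ := hcon y hy.1 hy.2
    have h3 : r ≤ dist (φ y) X0 := by
      refine le_trans ?_ (dist_le_pi_dist (φ y) X0 j)
      have : dist (φ y j) (X0 j) = ‖(((v j : ℝ) * y - x0 j : ℝ) : UnitAddCircle)‖ := by
        rw [dist_eq_norm]; rfl
      rw [this, UnitAddCircle.norm_eq]
      exact hj _
    simp only [g, g0, ContinuousMap.coe_mk]
    rw [max_eq_left (by linarith)]; simp
  have h4 : ‖∫ y in (0:ℝ)..1, p (φ y)‖ ≤ δ / 3 := by
    have := intervalIntegral.norm_integral_le_of_norm_le_const (a := (0:ℝ)) (b := 1) (f := fun y => p (φ y)) (C := δ / 3) (by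
      intro y hy
      rw [uIoc_of_le zero_le_one] at hy
      have h5 := hbd (φ y)
      rw [hg y ⟨hy.1.le, hy.2⟩, zero_sub, norm_neg] at h5
      exact h5)
    simpa using this
  have h5 : ‖(∫ x, g x ∂μ) - ∫ x, p x ∂μ‖ ≤ δ / 3 := by
    rw [← integral_sub (hIntg g) (hIntg p)]
    have := norm_integral_le_of_norm_le_const (μ := μ) (f := fun x => g x - p x) (C := δ / 3)
      (Filter.Eventually.of_forall hbd)
    simpa using this
  rw [h1, ← h2, hgδ] at h5
  have h6 : ‖(δ : ℂ)‖ = δ := by simp [abs_of_pos hδ0]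
  have h7 := norm_sub_norm_le (δ : ℂ) (∫ y in (0:ℝ)..1, p (φ y))
  linarith

lemma avoid_rel {d : Type} [Fintype d] (F : Finset (d → ℤ)) (hF : (0 : d → ℤ) ∉ F) :
    ∃ W : ℕ, ∀ c u : d → ℝ, Function.Injective c → (∀ j, 0 < c j) → (∀ j, u j ≠ 0) →
      ∃ t : ℕ, 1 ≤ t ∧ t ≤ W ∧ ∀ k ∈ F, ∑ j, (k j : ℝ) * (u j * c j ^ t) ≠ 0 := by
  classical
  obtain ⟨ι, _inst, hι⟩ :=
    Combinatorics.Line.exists_mono_in_high_dimension (Fin (Fintype.card d)) F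
  refine ⟨1 + Fintype.card ι * Fintype.card d, fun c u hc hc0 hu => ?_⟩
  by_contra! hcon
  have key : ∀ w : ι → Fin (Fintype.card d), ∃ k : F,
      ∑ j, (k.1 j : ℝ) * (u j * c j ^ (1 + ∑ l, (w l : ℕ))) = 0 := by
    intro w
    obtain ⟨k, hk, h⟩ := hcon (1 + ∑ l, (w l : ℕ)) (by omega) (by
      have : ∑ l, (w l : ℕ) ≤ ∑ l : ι, Fintype.card d :=
        Finset.sum_le_sum fun l _ => (w l).2.le
      simpa using this)
    exact ⟨⟨k, hk⟩, h⟩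
  choose C hC using key
  obtain ⟨l, k, hl⟩ := hι C
  set s : Finset ι := {i | l.idxFun i = none} with hs
  have hspos : 0 < s.card := Finset.card_pos.mpr ⟨l.proper.choose, by
    rw [hs, Finset.mem_filter]; exact ⟨Finset.mem_univ _, l.proper.choose_spec⟩⟩
  let b : ℕ := ∑ i ∈ sᶜ, ((l.idxFun i).map (fun x => (x : ℕ))).getD 0
  have hsum : ∀ x : Fin (Fintype.card d), ∑ i, ((l x i : Fin _) : ℕ) = s.card * (x : ℕ) + b := by
    intro x
    rw [← Finset.sum_add_sum_compl s]
    congr 1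
    · rw [← smul_eq_mul, ← Finset.sum_const]
      apply Finset.sum_congr rfl
      intro i hi
      rw [hs, Finset.mem_filter] at hi
      rw [l.apply_none _ _ hi.right]
    · apply Finset.sum_congr rfl
      intro i hi
      rw [hs, Finset.compl_filter, Finset.mem_filter] at hi
      obtain ⟨y, hy⟩ := Option.ne_none_iff_exists.mp hi.right
      simp [← hy]
  let e := Fintype.equivFin d
  have hz := Matrix.eq_zero_of_forall_pow_sum_mul_pow_eq_zero
    (f := fun j : Fin (Fintype.card d) => c (e.symm j) ^ s.card)
    (v := fun j => (k.1 (e.symm j) : ℝ) * (u (e.symm j) * c (e.symm j) ^ (1 + b)))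
    (by
      intro x y hxy
      have := (pow_left_inj₀ (hc0 _).le (hc0 _).le hspos.ne').1 hxy
      exact e.symm.injective (hc this))
    (by
      intro x
      have h1 := hC (l x)
      rw [hl x, hsum x] at h1
      rw [← h1, ← e.symm.sum_comp]
      apply Finset.sum_congr rfl
      intro j _
      rw [← pow_mul, show 1 + (s.card * (x : ℕ) + b) = (1 + b) + s.card * (x : ℕ) by ring, pow_add (c (e.symm j)) (1+b)]
      ring)
  apply hF
  have : k.1 = 0 := by
    funext j
    have := congrFun hz (e j)
    simp only [Equiv.symm_apply_apply, Pi.zero_apply, mul_eq_zero] at this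
    rcases this with h | h | h
    · exact_mod_cast h
    · exact absurd h (hu j)
    · exact absurd h (pow_pos (hc0 j) _).ne'
  rw [← this]; exact k.2

lemma dirichlet {ι : Type} [Fintype ι] (P : ι → ℕ) (hP : ∀ i, 2 ≤ P i) (q : ℕ) (hq : 2 ≤ q)
    (ε : ℝ) (hε : 0 < ε) (n0 : ℕ) :
    ∃ n : ℕ, n0 ≤ n ∧ 1 ≤ n ∧ ∃ Δ : ι → ℕ, ∀ i, 1 ≤ Δ i ∧
      |(n : ℝ) * Real.log q - Δ i * Real.log (P i)| < ε := by
  have hlog : ∀ i, 0 < Real.log (P i) := fun i => Real.log_pos (by exact_mod_cast hP i)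
  have hlq : 0 < Real.log q := Real.log_pos (by exact_mod_cast hq)
  obtain ⟨D, hD0, hD⟩ : ∃ D : ℝ, 0 < D ∧ ∀ i, Real.log (P i) ≤ D :=
    ⟨1 + ∑ i, Real.log (P i), by positivity, fun i => by
      have := Finset.single_le_sum (f := fun i => Real.log (P i)) (fun i _ => (hlog i).le) (Finset.mem_univ i)
      linarith⟩
  let x : ι → UnitAddCircle := fun i => ((Real.log q / Real.log (P i) : ℝ) : UnitAddCircle)
  have hcl := mapClusterPt_zero_atTop_nsmul x
  have hfr := hcl.frequently (Metric.ball_mem_nhds 0 (show 0 < ε / D by positivity))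
  obtain ⟨n1, hn1⟩ := exists_nat_gt (ε / Real.log q)
  obtain ⟨n, hn, hball⟩ := (Filter.frequently_atTop.1 hfr) (max n0 (max 1 n1))
  refine ⟨n, by omega, by omega, ?_⟩
  have hi : ∀ i, ∃ Δ : ℕ, 1 ≤ Δ ∧ |(n : ℝ) * Real.log q - Δ * Real.log (P i)| < ε := by
    intro i
    rw [dist_zero_right] at hball
    have h1 := (norm_le_pi_norm (n • x) i).trans_lt hball
    have h2 : (n • x) i = (((n : ℝ) * (Real.log q / Real.log (P i)) : ℝ) : UnitAddCircle) := by
      simp [x, ← nsmul_eq_mul]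
    rw [h2, UnitAddCircle.norm_eq] at h1
    set r := round ((n : ℝ) * (Real.log q / Real.log (P i))) with hr
    have h3 : |(n : ℝ) * Real.log q - r * Real.log (P i)| < ε := by
      have : (n : ℝ) * Real.log q - r * Real.log (P i)
        = ((n : ℝ) * (Real.log q / Real.log (P i)) - r) * Real.log (P i) := by
          have := (hlog i).ne'
          field_simp
      rw [this, abs_mul, abs_of_pos (hlog i)]
      calc _ < ε / D * Real.log (P i) := by gcongr; exact hlog i
        _ ≤ ε / D * D := by gcongr; exact hD i
        _ = ε := by field_simp
    have h4 : 0 < r := by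
      have hn2 : (n1 : ℝ) ≤ n := by exact_mod_cast (by omega : n1 ≤ n)
      rw [div_lt_iff₀ hlq] at hn1
      have h5 : (n1 : ℝ) * Real.log q ≤ n * Real.log q := by gcongr
      have h6 := (abs_lt.1 h3).2
      have h7 : 0 < (r : ℝ) * Real.log (P i) := by linarith
      exact_mod_cast (pos_iff_pos_of_mul_pos h7).2 (hlog i)
    refine ⟨r.toNat, by omega, ?_⟩
    have : ((r.toNat : ℕ) : ℝ) = r := by
      have : ((r.toNat : ℕ) : ℤ) = r := by omega
      exact_mod_cast this
    rw [this]; exact h3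
  choose Δ hΔ using hi
  exact ⟨Δ, hΔ⟩


lemma core {M : ℕ} (P : Fin (M + 1) → ℕ) (hP : ∀ i, (P i).Prime) (hinj : Function.Injective P)
    (A B η D : ℝ) (hA : 0 ≤ A) (hAB : A < B) (hB : B ≤ 1) (hη : 0 < η) (hD : ∀ i, (P i : ℝ) ≤ D) :
    ∃ (m : ℕ) (mi : Fin (M + 1) → ℕ) (y : ℝ) (e0 : ℤ) (e : Fin (M + 1) → ℤ),
      A + (B - A) / 4 < y ∧ y < B - (B - A) / 4 ∧
      1 < (P 0 : ℝ) ^ m * ((B - A) / 4) ∧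
      0 ≤ (P 0 : ℝ) ^ m * y - e0 - (1 - 1 / (P 0 : ℝ)) ∧
      (P 0 : ℝ) ^ m * y - e0 - (1 - 1 / (P 0 : ℝ)) < η ∧
      ∀ i, i ≠ 0 → 1 < (P i : ℝ) ^ (mi i) * ((B - A) / 4) ∧
        (P i : ℝ) ^ (mi i + 1) ≤ (P 0 : ℝ) ^ m ∧
        (P 0 : ℝ) ^ m ≤ 2 * P 0 * (P i : ℝ) ^ (mi i + 1) ∧
        0 < e i + 1 / (P i : ℝ) - (P i : ℝ) ^ (mi i) * y ∧
        e i + 1 / (P i : ℝ) - (P i : ℝ) ^ (mi i) * y < η := by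
  classical
  set ρ := (B - A) / 4 with hρ
  have hρ0 : 0 < ρ := by rw [hρ]; linarith
  set q := P 0 with hq
  have hq2 : 2 ≤ q := (hP 0).two_le
  have hP2 : ∀ i, 2 ≤ P i := fun i => (hP i).two_le
  have hPpos : ∀ i, (0:ℝ) < P i := fun i => by exact_mod_cast (hP i).pos
  have hq2r : (2:ℝ) ≤ q := by exact_mod_cast hq2
  have hD1 : 2 ≤ D := hq2r.trans (hD 0)
  let x0 : Option (Fin (M + 1)) → ℝ := fun j => match j with
    | none => (A + B) / 2
    | some i => if i = 0 then 1 - 1 / (q : ℝ) + η / 2 else 1 / (P i : ℝ) - η / 2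
  obtain ⟨F, hF0, hF⟩ := kronecker x0 (min (η / 2) ρ) (by positivity)
  obtain ⟨W, hW⟩ := avoid_rel F hF0
  obtain ⟨n0, hn0⟩ := exists_nat_gt (2 * q * D / ρ)
  have hl2 : 0 < Real.log 2 := Real.log_pos (by norm_num)
  obtain ⟨n, hnn0, hn1, Δ, hΔ⟩ := dirichlet P hP2 q hq2 (Real.log 2 / (W + 1)) (by positivity) n0
  let E : Fin (M + 1) → ℕ := fun i => if i = 0 then n else Δ i
  have hE1 : ∀ i, 1 ≤ E i := by
    intro i; simp only [E]; split_ifs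
    · exact hn1
    · exact (hΔ i).1
  have hE2 : ∀ i, |(n : ℝ) * Real.log q - E i * Real.log (P i)| < Real.log 2 / (W + 1) := by
    intro i; simp only [E]; split_ifs with h
    · subst h; simp only [← hq, sub_self, abs_zero]; positivity
    · exact (hΔ i).2
  let c : Option (Fin (M + 1)) → ℝ := fun j => match j with
    | none => 1
    | some i => (P i : ℝ) ^ (E i)
  let u : Option (Fin (M + 1)) → ℝ := fun j => match j with
    | none => 1
    | some i => if i = 0 then (q : ℝ) else 1 / (P i : ℝ)
  obtain ⟨t, ht1, htW, ht⟩ := hW c u (by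
      have hgt : ∀ i, (1:ℝ) < (P i : ℝ) ^ (E i) := fun i =>
        one_lt_pow₀ (by exact_mod_cast (hP i).one_lt) (by have := hE1 i; omega)
      rintro (_ | i) (_ | j) h
      · rfl
      · exact absurd h (hgt j).ne
      · exact absurd h (hgt i).ne'
      · have h' : P i ^ E i = P j ^ E j := by
          simp only [c] at h; exact_mod_cast h
        have hd : P i ∣ P j ^ E j := by
          rw [← h']; exact dvd_pow_self _ (by have := hE1 i; omega)
        have := (Nat.prime_dvd_prime_iff_eq (hP i) (hP j)).1 ((hP i).dvd_of_dvd_pow hd)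
        rw [hinj this])
    (by
      rintro (_ | i)
      · exact one_pos
      · exact pow_pos (hPpos i) _)
    (by
      rintro (_ | i)
      · exact one_ne_zero
      · simp only [u]; split_ifs
        · exact (hPpos 0).ne'
        · exact (one_div_pos.2 (hPpos i)).ne')
  have hpred : ∀ i, t * E i - 1 + 1 = t * E i := fun i => by
    have : 1 ≤ t * E i := Nat.mul_pos ht1 (hE1 i)
    omega
  let v : Option (Fin (M + 1)) → ℤ := fun j => match j with
    | none => 1
    | some i => if i = 0 then (q : ℤ) ^ (t * n + 1) else (P i : ℤ) ^ (t * E i - 1)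
  have huv : ∀ j, (v j : ℝ) = u j * c j ^ t := by
    rintro (_ | i)
    · simp [u, v, c]
    · by_cases h : i = 0
      · subst h
        simp only [u, v, c, E, if_true, ← hq]
        push_cast
        rw [← pow_mul, mul_comm n t, pow_succ]; ring
      · simp only [u, v, c, h, if_false]
        push_cast
        rw [← pow_mul, mul_comm (E i) t, ← hpred i, pow_succ]
        simp only [hpred]
        have := (hPpos i).ne'
        field_simp
  obtain ⟨y, hy0, hy1, hy⟩ := hF v (by
    intro k hk h
    apply ht k hk
    have : ((∑ j, k j * v j : ℤ) : ℝ) = 0 := by exact_mod_cast h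
    push_cast at this
    rw [← this]
    exact Finset.sum_congr rfl fun j _ => by rw [huv])
  choose f hf using hy
  -- comparison of sizes
  have hcmp : ∀ i, (P i : ℝ) ^ (t * E i) ≤ 2 * (q : ℝ) ^ (t * n) ∧
      (q : ℝ) ^ (t * n) ≤ 2 * (P i : ℝ) ^ (t * E i) := by
    intro i
    have hqp : (0:ℝ) < q := hPpos 0
    have h1 : |(t : ℝ) * ((n : ℝ) * Real.log q - E i * Real.log (P i))| ≤ Real.log 2 := by
      rw [abs_mul, abs_of_nonneg (Nat.cast_nonneg t)]
      have h2 : (t : ℝ) ≤ W + 1 := by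
        have : (t : ℝ) ≤ W := by exact_mod_cast htW
        linarith
      calc (t : ℝ) * _ ≤ (W + 1) * (Real.log 2 / (W + 1)) :=
            mul_le_mul h2 (hE2 i).le (abs_nonneg _) (by positivity)
        _ = Real.log 2 := by field_simp
    have hle := abs_le.1 h1
    have hpp : (0:ℝ) < (P i : ℝ) ^ (t * E i) := pow_pos (hPpos i) _
    have hqq : (0:ℝ) < (q : ℝ) ^ (t * n) := pow_pos hqp _
    constructor
    · rw [← Real.log_le_log_iff hpp (by positivity), Real.log_mul (by norm_num) hqq.ne',
        Real.log_pow, Real.log_pow]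
      push_cast; linarith [hle.1]
    · rw [← Real.log_le_log_iff hqq (by positivity), Real.log_mul (by norm_num) hpp.ne',
        Real.log_pow, Real.log_pow]
      push_cast; linarith [hle.2]
  have hbig : 2 * q * D < (q : ℝ) ^ (t * n + 1) * ρ := by
    rw [div_lt_iff₀ hρ0] at hn0
    refine hn0.trans_le (mul_le_mul_of_nonneg_right ?_ hρ0.le)
    have h1 : n0 < 2 ^ n0 := Nat.lt_two_pow_self
    have h2 : (n0 : ℝ) ≤ (2:ℝ) ^ n0 := by exact_mod_cast h1.le
    refine h2.trans ?_
    calc (2:ℝ) ^ n0 ≤ (q : ℝ) ^ n0 := by gcongr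
      _ ≤ (q : ℝ) ^ (t * n + 1) := by
        apply pow_le_pow_right₀ (by linarith)
        nlinarith
  have hr1 : min (η / 2) ρ ≤ η / 2 := min_le_left _ _
  have hr2 : min (η / 2) ρ ≤ ρ := min_le_right _ _
  refine ⟨t * n + 1, fun i => t * E i - 1, y, f (some 0), fun i => f (some i), ?_⟩
  have hy' : |y - (A + B) / 2| < ρ := by
    have h := (hf none).trans_le hr2
    simp only [v, x0, Int.cast_one, one_mul] at h
    have h3 := abs_lt.1 h
    have : f none = 0 := by
      by_contra hne
      rcases lt_or_gt_of_ne hne with h1 | h1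
      · have : (f none : ℝ) ≤ -1 := by exact_mod_cast (by omega : f none ≤ -1)
        linarith [h3.2]
      · have : (1 : ℝ) ≤ f none := by exact_mod_cast (by omega : 1 ≤ f none)
        linarith [h3.1]
    rw [this] at h; simpa using h
  have hy'' := abs_lt.1 hy'
  have h0 := abs_lt.1 ((hf (some 0)).trans_le hr1)
  simp only [v, x0, if_true] at h0
  push_cast at h0
  refine ⟨by linarith [hy''.1], by linarith [hy''.2], ?_, by linarith [h0.1], by linarith [h0.2], ?_⟩
  · refine lt_trans ?_ hbig
    nlinarith
  · intro i hi
    have h0 := abs_lt.1 ((hf (some i)).trans_le hr1)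
    simp only [v, x0, hi, if_false] at h0
    push_cast at h0
    have h2 : (q : ℝ) ^ (t * n + 1) ≤ 2 * q * (P i : ℝ) ^ (t * E i) := by
      rw [pow_succ]; nlinarith [(hcmp i).2]
    simp only [hpred]
    refine ⟨?_, ?_, h2, by linarith [h0.2], by linarith [h0.1]⟩
    · rw [← hpred i, pow_succ (P i : ℝ)] at h2
      by_contra! hcon
      set X := (P i : ℝ) ^ (t * E i - 1) with hX
      have hX0 : 0 < X := pow_pos (hPpos i) _
      have h3 : (q : ℝ) ^ (t * n + 1) * ρ ≤ 2 * q * P i * (X * ρ) := by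
        calc _ ≤ (2 * q * (X * P i)) * ρ := by gcongr
          _ = _ := by ring
      have h4 : 2 * q * P i * (X * ρ) ≤ 2 * q * D * 1 := by
        have := hD i; have := hPpos i
        gcongr
      linarith
    · rw [pow_succ]
      have := (hcmp i).1
      have h5 : (0:ℝ) < (q:ℝ) ^ (t * n) := pow_pos (hPpos 0) _
      nlinarith


lemma smallest_of_s9 (p : ℕ) (hp : 2 ≤ p) (m k : ℤ) (s : Set ℝ) (z : ℝ)
    (hs : s ⊆ adicInterval p m k) (hzs : z ∈ s) (hU : Upt p m k ∈ s) (hz : z < Upt p m k) :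
    IsSmallestAdicContaining p m k s := by
  refine ⟨hs, fun m' k' h => ?_⟩
  have hp0 : (0:ℝ) < p := by exact_mod_cast (by omega : 0 < p)
  rcases le_or_gt m' m with hm | hm
  · obtain ⟨r, hr⟩ := Int.eq_ofNat_of_zero_le (sub_nonneg.2 hm)
    have hmr : (p : ℝ) ^ m = (p : ℝ) ^ m' * (p : ℝ) ^ r := by
      rw [← zpow_natCast, ← zpow_add₀ hp0.ne']; congr 1; omega
    have h1 := hs hzs
    have h2 := h hzs
    simp only [adicInterval, mem_Ico] at h1 h2
    have hX : (0:ℝ) < (p:ℝ) ^ m' := zpow_pos hp0 _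
    have hR : (0:ℝ) < (p:ℝ) ^ r := pow_pos hp0 _
    rw [hmr] at h1
    have e1 : ∀ a : ℝ, a / (p:ℝ) ^ m' = a * (p:ℝ) ^ r / ((p:ℝ) ^ m' * (p:ℝ) ^ r) := fun a => by
      field_simp
    rw [e1 k', e1] at h2
    have hXR : (0:ℝ) < (p:ℝ) ^ m' * (p:ℝ) ^ r := by positivity
    have h3 : ((k:ℝ) - 1) < k' * (p:ℝ) ^ r := by
      have := h1.1.trans_lt h2.2
      rwa [div_lt_div_iff_of_pos_right hXR] at this
    have h4 : ((k':ℝ) - 1) * (p:ℝ) ^ r < k := by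
      have := h2.1.trans_lt h1.2
      rwa [div_lt_div_iff_of_pos_right hXR] at this
    have h3' : k - 1 < k' * (p:ℤ) ^ r := by exact_mod_cast h3
    have h4' : (k' - 1) * (p:ℤ) ^ r < k := by exact_mod_cast h4
    have h3'' : (k:ℝ) ≤ k' * (p:ℝ) ^ r := by exact_mod_cast (by omega : k ≤ k' * (p:ℤ) ^ r)
    have h4'' : ((k':ℝ) - 1) * (p:ℝ) ^ r ≤ k - 1 := by
      exact_mod_cast (by omega : (k' - 1) * (p:ℤ) ^ r ≤ k - 1)
    simp only [adicInterval]
    rw [hmr, e1 k', e1]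
    apply Ico_subset_Ico <;> gcongr
  · exfalso
    obtain ⟨r, hr⟩ := Int.eq_ofNat_of_zero_le (sub_nonneg.2 (by omega : m + 1 ≤ m'))
    have hmr : (p : ℝ) ^ m' = (p : ℝ) ^ (m + 1) * (p : ℝ) ^ r := by
      rw [← zpow_natCast, ← zpow_add₀ hp0.ne']; congr 1; omega
    have h1 := h hU
    have h2 := h hzs
    simp only [adicInterval, mem_Ico] at h1 h2
    have hX : (0:ℝ) < (p:ℝ) ^ m' := zpow_pos hp0 _
    have hUe : Upt p m k = (((k - 1) * p + 1) * (p:ℤ) ^ r : ℤ) / (p:ℝ) ^ m' := by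
      have hR : (0:ℝ) < (p:ℝ) ^ r := pow_pos hp0 _
      have hY : (0:ℝ) < (p:ℝ) ^ m := zpow_pos hp0 _
      rw [hmr, Upt, zpow_add_one₀ hp0.ne']
      push_cast
      field_simp
    rw [hUe] at h1 hz
    have h3 := h1.2
    rw [div_lt_div_iff_of_pos_right hX] at h3
    have h4 := h2.1.trans_lt hz
    rw [div_lt_div_iff_of_pos_right hX] at h4
    have h3' : ((k - 1) * p + 1) * (p:ℤ) ^ r < k' := by exact_mod_cast h3
    have h4' : k' - 1 < ((k - 1) * p + 1) * (p:ℤ) ^ r := by exact_mod_cast h4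
    omega

set_option maxHeartbeats 1600000 in
lemma block {M : ℕ} (P : Fin (M + 1) → ℕ) (hP : ∀ i, (P i).Prime) (hinj : Function.Injective P)
    (a : ℕ) (ha : 1 ≤ a) (A B : ℝ) (hA : 0 ≤ A) (hAB : A < B) (hB : B ≤ 1) :
    ∃ (m k : ℤ) (mJ kJ : Fin (M + 1) → ℤ),
      adicInterval (P 0) m k ⊆ Set.Ico A B ∧
      ∀ i, i ≠ 0 →
        IsSmallestAdicContaining (P i) (mJ i) (kJ i) (adicInterval (P 0) m k) ∧
        adicInterval (P i) (mJ i) (kJ i) ⊆ Set.Ico A B ∧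
        0 < Upt (P i) (mJ i) (kJ i) - Zpt (P 0) m k ∧
        Upt (P i) (mJ i) (kJ i) - Zpt (P 0) m k ≤
          ((P 0 : ℕ) : ℝ) ^ (-(100 * (a : ℤ))) * ((P 0 : ℕ) : ℝ) ^ (-m) := by
  have hPpos : ∀ i, (0:ℝ) < P i := fun i => by exact_mod_cast (hP i).pos
  have hP2 : ∀ i, (2:ℝ) ≤ P i := fun i => by exact_mod_cast (hP i).two_le
  obtain ⟨D, hD⟩ : ∃ D : ℝ, ∀ i, (P i : ℝ) ≤ D := ⟨∑ i, (P i : ℝ), fun i =>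
    Finset.single_le_sum (f := fun i => (P i : ℝ)) (fun i _ => (hPpos i).le) (Finset.mem_univ i)⟩
  have hD0 : 0 < D := (hPpos 0).trans_le (hD 0)
  set κ : ℝ := (P 0 : ℝ) ^ (-(100 * (a : ℤ))) with hκ
  have hκ0 : 0 < κ := zpow_pos (hPpos 0) _
  have hκ1 : κ < 1 / P 0 := by
    rw [hκ, one_div, ← zpow_neg_one]
    exact zpow_lt_zpow_right₀ (by linarith [hP2 0]) (by omega)
  have hη0 : 0 < κ / (1 + 2 * P 0 * D) := by have := hPpos 0; positivity
  obtain ⟨m, mi, y, e0, e, hyA, hyB, hmρ, hz0, hz1, hi⟩ :=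
    core P hP hinj A B (κ / (1 + 2 * P 0 * D)) D hA hAB hB hη0 hD
  set η := κ / (1 + 2 * P 0 * D) with hη
  set ρ := (B - A) / 4 with hρ
  have hρ0 : 0 < ρ := by rw [hρ]; linarith
  set q : ℝ := (P 0 : ℝ) with hq
  have hq0 : 0 < q := hPpos 0
  have hηκ : η * (1 + 2 * q * D) = κ := by rw [hη]; field_simp
  have hηle : η ≤ κ := by
    rw [← hηκ]
    have : 0 ≤ η * (2 * q * D) := by positivity
    linarith
  set Q : ℝ := q ^ m with hQ
  have hQ0 : 0 < Q := pow_pos hq0 _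
  set θ := Q * y - e0 - (1 - 1 / q) with hθ
  have hQinv : 1 / Q < ρ := by
    rw [div_lt_iff₀ hQ0]; linarith
  have hl : (((e0 + 1 : ℤ) : ℝ) - 1) / q ^ (m : ℤ) = y - (1 - 1 / q + θ) / Q := by
    rw [zpow_natCast, ← hQ, hθ]; push_cast; field_simp; ring
  have hr : (((e0 + 1 : ℤ) : ℝ)) / q ^ (m : ℤ) = y + (1 / q - θ) / Q := by
    rw [zpow_natCast, ← hQ, hθ]; push_cast; field_simp; ring
  have hZ : Zpt (P 0) m (e0 + 1) = y - θ / Q := by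
    rw [Zpt, zpow_add_one₀ hq0.ne', ← hq, hl, zpow_natCast, ← hQ]; field_simp; ring
  have hq1 : 1 / q ≤ 1 / 2 := one_div_le_one_div_of_le (by norm_num) (hP2 0)
  have hq1' : 0 < 1 / q := by positivity
  have hIdef : adicInterval (P 0) m (e0 + 1) =
      Ico (y - (1 - 1 / q + θ) / Q) (y + (1 / q - θ) / Q) := by
    rw [adicInterval, ← hq, hl, hr]
  have hθκ : θ < 1 / q := by linarith
  refine ⟨m, e0 + 1, fun i => mi i, fun i => e i + 1, ?_, ?_⟩
  · rw [hIdef]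
    have h1 : (1 - 1 / q + θ) / Q ≤ 1 / Q := by gcongr; linarith
    have h2 : (1 / q - θ) / Q ≤ 1 / Q := by gcongr; linarith
    exact Ico_subset_Ico (by linarith) (by linarith)
  · intro i hine
    obtain ⟨h1, h2, h3, h4, h5⟩ := hi i hine
    set p : ℝ := (P i : ℝ) with hp
    have hp0 : 0 < p := hPpos i
    have hp2 : 2 ≤ p := hP2 i
    set N : ℝ := p ^ mi i with hN
    have hN0 : 0 < N := pow_pos hp0 _
    rw [pow_succ, ← hN] at h2 h3
    set τ := e i + 1 / p - N * y with hτ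
    have hNinv : 1 / N < ρ := by
      rw [div_lt_iff₀ hN0]; linarith
    have hU : Upt (P i) (mi i) (e i + 1) = y + τ / N := by
      rw [Upt, zpow_add_one₀ hp0.ne', ← hp, zpow_natCast, ← hN, hτ]
      push_cast; field_simp; ring
    have hJdef : adicInterval (P i) (mi i) (e i + 1) =
        Ico (y + τ / N - 1 / (N * p)) (y + τ / N + (p - 1) / (N * p)) := by
      rw [adicInterval, ← hp, zpow_natCast, ← hN, hτ]
      push_cast
      congr 1 <;> field_simp <;> ring
    have hdiff : τ / N + θ / Q ≤ κ / Q := by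
      have e1 : τ / N ≤ η * (2 * q * D) / Q := by
        rw [div_le_div_iff₀ hN0 hQ0]
        calc τ * Q ≤ η * (2 * q * (N * p)) := by gcongr
          _ ≤ η * (2 * q * (N * D)) := by gcongr; exact hD i
          _ = _ := by ring
      have e2 : θ / Q ≤ η / Q := by gcongr
      calc _ ≤ η * (2 * q * D) / Q + η / Q := add_le_add e1 e2
        _ = κ / Q := by rw [← hηκ]; ring
    have hτN : 0 < τ / N := by positivity
    have hθQ : 0 ≤ θ / Q := by positivity
    have hinv : 1 / Q ≤ 1 / (N * p) := by
      apply one_div_le_one_div_of_le (by positivity) h2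
    have hκQ : κ / Q < 1 / q / Q := by gcongr
    have hsub1 : (1 - 1 / q + θ) / Q = 1 / Q - 1 / q / Q + θ / Q := by ring
    have hsub2 : (1 / q - θ) / Q = 1 / q / Q - θ / Q := by ring
    have hp1 : 1 / (N * p) ≤ (p - 1) / (N * p) := by gcongr; linarith
    have hqQ : 1 / q / Q ≤ 1 / Q := by gcongr; linarith
    have hqQ2 : 1 / q / Q ≤ 1 / 2 / Q := by gcongr
    have hqQ3 : 1 / 2 / Q = 1 / Q / 2 := by ring
    have hQp : 0 < 1 / Q := by positivity
    refine ⟨?_, ?_, ?_, ?_⟩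
    · apply smallest_of_s9 (P i) (hP i).two_le (mi i) (e i + 1) _ y
      · rw [hIdef, hJdef]
        apply Ico_subset_Ico <;> linarith
      · rw [hIdef, hsub1, hsub2]
        constructor <;> linarith
      · rw [hU, hIdef, hsub1, hsub2]
        constructor <;> linarith
      · rw [hU]; linarith
    · rw [hJdef]
      have hNp : 1 / (N * p) ≤ 1 / N := by
        apply one_div_le_one_div_of_le hN0; nlinarith
      have hNp2 : (p - 1) / (N * p) = 1 / N - 1 / (N * p) := by field_simp
      apply Ico_subset_Ico <;> linarith
    · rw [hU, hZ]; linarith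
    · rw [hU, hZ, zpow_neg, zpow_natCast, ← hQ, ← div_eq_mul_inv]; linarith

/-- (Selection of building blocks, finitely many primes with `P 0` smallest.)  There are
sequences of `P 0`-adic intervals `I_ℓ ⊆ [0,1)` and positive integers `α_ℓ` such that for
each `i ≠ 0`: the smallest `P i`-adic intervals `J_i^ℓ ⊇ I_ℓ` are pairwise disjoint and
contained in `[0,1)` (in particular the `I_ℓ` are pairwise disjoint); each value `α` is
attained by only finitely many `α_ℓ`; and
`0 < Υ(J_i^ℓ) - Z(I_ℓ) ≤ (P 0)^(-100 α_ℓ) |I_ℓ|` for all `ℓ` and all `i ≠ 0`. -/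
theorem selection_many_primes (M : ℕ) (P : Fin (M + 1) → ℕ) (hP : ∀ i, (P i).Prime)
    (hinj : Function.Injective P) (hmin : ∀ i, P 0 ≤ P i) :
    ∃ (mI kI : ℕ → ℤ) (α : ℕ → ℕ) (mJ kJ : Fin (M + 1) → ℕ → ℤ),
      (∀ ℓ, 1 ≤ α ℓ) ∧
      (∀ ℓ, adicInterval (P 0) (mI ℓ) (kI ℓ) ⊆ Set.Ico (0 : ℝ) 1) ∧
      (∀ i : Fin (M + 1), i ≠ 0 → ∀ ℓ,
        IsSmallestAdicContaining (P i) (mJ i ℓ) (kJ i ℓ)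
          (adicInterval (P 0) (mI ℓ) (kI ℓ)) ∧
        adicInterval (P i) (mJ i ℓ) (kJ i ℓ) ⊆ Set.Ico (0 : ℝ) 1) ∧
      (∀ i : Fin (M + 1), i ≠ 0 → ∀ ℓ ℓ', ℓ ≠ ℓ' →
        Disjoint (adicInterval (P i) (mJ i ℓ) (kJ i ℓ))
          (adicInterval (P i) (mJ i ℓ') (kJ i ℓ'))) ∧
      (∀ ℓ ℓ', ℓ ≠ ℓ' →
        Disjoint (adicInterval (P 0) (mI ℓ) (kI ℓ))
          (adicInterval (P 0) (mI ℓ') (kI ℓ'))) ∧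
      (∀ a : ℕ, {ℓ : ℕ | α ℓ = a}.Finite) ∧
      (∀ i : Fin (M + 1), i ≠ 0 → ∀ ℓ,
        0 < Upt (P i) (mJ i ℓ) (kJ i ℓ) - Zpt (P 0) (mI ℓ) (kI ℓ) ∧
        Upt (P i) (mJ i ℓ) (kJ i ℓ) - Zpt (P 0) (mI ℓ) (kI ℓ) ≤
          ((P 0 : ℕ) : ℝ) ^ (-(100 * (α ℓ : ℤ))) * ((P 0 : ℕ) : ℝ) ^ (-(mI ℓ))) := by
  have hlt : ∀ ℓ : ℕ, (1:ℝ) / (ℓ + 2) < 1 / (ℓ + 1) := fun ℓ =>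
    one_div_lt_one_div_of_lt (by positivity) (by linarith)
  have hle1 : ∀ ℓ : ℕ, (1:ℝ) / (ℓ + 1) ≤ 1 := fun ℓ => by
    rw [div_le_one (by positivity)]
    have : (0:ℝ) ≤ ℓ := Nat.cast_nonneg _
    linarith
  have hb := fun ℓ : ℕ => block P hP hinj (ℓ + 1) (by omega) (1 / ((ℓ:ℝ) + 2)) (1 / ((ℓ:ℝ) + 1))
    (by positivity) (hlt ℓ) (hle1 ℓ)
  choose m k mJ kJ hI hJ using hb
  have hsub : ∀ ℓ : ℕ, Set.Ico (1 / ((ℓ:ℝ) + 2)) (1 / ((ℓ:ℝ) + 1)) ⊆ Set.Ico (0:ℝ) 1 := fun ℓ =>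
    Ico_subset_Ico (by positivity) (hle1 ℓ)
  have hdis' : ∀ ℓ ℓ' : ℕ, ℓ < ℓ' → Disjoint (Set.Ico (1 / ((ℓ:ℝ) + 2)) (1 / ((ℓ:ℝ) + 1)))
      (Set.Ico (1 / ((ℓ':ℝ) + 2)) (1 / ((ℓ':ℝ) + 1))) := by
    intro ℓ ℓ' h
    rw [Set.disjoint_left]
    intro x hx hx'
    have h1 : (ℓ:ℝ) + 1 ≤ ℓ' := by exact_mod_cast h
    have h2 : (1:ℝ) / (ℓ' + 1) ≤ 1 / (ℓ + 2) :=
      one_div_le_one_div_of_le (by positivity) (by linarith)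
    linarith [hx.1, hx'.2]
  have hdis : ∀ ℓ ℓ' : ℕ, ℓ ≠ ℓ' → Disjoint (Set.Ico (1 / ((ℓ:ℝ) + 2)) (1 / ((ℓ:ℝ) + 1)))
      (Set.Ico (1 / ((ℓ':ℝ) + 2)) (1 / ((ℓ':ℝ) + 1))) := by
    intro ℓ ℓ' h
    rcases lt_or_gt_of_ne h with h | h
    · exact hdis' _ _ h
    · exact (hdis' _ _ h).symm
  refine ⟨m, k, fun ℓ => ℓ + 1, fun i ℓ => mJ ℓ i, fun i ℓ => kJ ℓ i, fun ℓ => by simp,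
    fun ℓ => (hI ℓ).trans (hsub ℓ), fun i hi ℓ => ⟨(hJ ℓ i hi).1, (hJ ℓ i hi).2.1.trans (hsub ℓ)⟩,
    fun i hi ℓ ℓ' h => (hdis ℓ ℓ' h).mono (hJ ℓ i hi).2.1 (hJ ℓ' i hi).2.1,
    fun ℓ ℓ' h => (hdis ℓ ℓ' h).mono (hI ℓ) (hI ℓ'), fun a => ?_,
    fun i hi ℓ => (hJ ℓ i hi).2.2⟩
  apply (Set.finite_le_nat a).subset
  intro ℓ h
  simp only [Set.mem_setOf_eq] at h ⊢
  omega
end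
end

section
/- Let p_1, …, p_M be distinct primes with p_1 the smallest. For every nondegenerate interval J̃ ⊆ [0,1] and every ε > 0 there exists a p_1-adic interval I ⊆ J̃ such that for every i ∈ {2, …, M}, 0 < Υ(J_i) − Z(I) ≤ ε·|I|, where J_i is the smallest p_i-adic interval containing I. -/
open Set

noncomputable section

theorem aux_integral_mFourier {d : Type*} [Fintype d] (n : d → ℤ) (hn : n ≠ 0) :
    ∫ x : UnitAddTorus d, UnitAddTorus.mFourier n x = 0 := by
  classical
  obtain ⟨i, hi⟩ : ∃ i, n i ≠ 0 := by
    by_contra h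
    push Not at h
    exact hn (funext h)
  refine MeasureTheory.integral_eq_zero_of_add_right_eq_neg
    (g := (Pi.single i (((1 : ℝ) / 2 / (n i) : ℝ) : UnitAddCircle) : d → UnitAddCircle)) ?_
  intro x
  simp only [UnitAddTorus.mFourier, ContinuousMap.coe_mk]
  rw [← Finset.mul_prod_erase Finset.univ _ (Finset.mem_univ i),
    ← Finset.mul_prod_erase Finset.univ (fun j => fourier (n j) (x j)) (Finset.mem_univ i)]
  rw [Pi.add_apply, Pi.single_eq_same, fourier_add_half_inv_index hi one_pos, neg_mul]
  congr 2
  refine Finset.prod_congr rfl fun j hj => ?_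
  rw [Pi.add_apply, Pi.single_eq_of_ne (Finset.ne_of_mem_erase hj), add_zero]

theorem aux_weyl {d : Type*} [Fintype d] (K : ℕ → ℕ) (hK : ∀ j, 0 < K j)
    (x : ℕ → ℕ → UnitAddTorus d)
    (h : ∀ n : d → ℤ, n ≠ 0 → ∀ᶠ j in Filter.atTop,
      ∑ k ∈ Finset.range (K j), UnitAddTorus.mFourier n (x j k) = 0)
    (f : C(UnitAddTorus d, ℂ)) :
    Filter.Tendsto (fun j => ((K j : ℂ))⁻¹ * ∑ k ∈ Finset.range (K j), f (x j k)) Filter.atTop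
      (nhds (∫ t, f t)) := by
  have hint : ∀ g : C(UnitAddTorus d, ℂ), MeasureTheory.Integrable (fun t => g t) := fun g =>
    g.continuous.integrable_of_hasCompactSupport (HasCompactSupport.of_compactSpace _)
  have hprob : MeasureTheory.IsProbabilityMeasure
      (MeasureTheory.volume : MeasureTheory.Measure (UnitAddTorus d)) := by
    constructor
    rw [MeasureTheory.volume_pi, MeasureTheory.Measure.pi_univ]
    simp
  have hspan : ∀ g ∈ Submodule.span ℂ (range (UnitAddTorus.mFourier (d := d))),
      Filter.Tendsto (fun j => ((K j : ℂ))⁻¹ * ∑ k ∈ Finset.range (K j), g (x j k)) Filter.atTop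
      (nhds (∫ t, g t)) := by
    intro g hg
    induction hg using Submodule.span_induction with
    | mem g hg =>
      obtain ⟨n, rfl⟩ := hg
      by_cases hn : n = 0
      · subst hn
        rw [UnitAddTorus.mFourier_zero]
        refine Filter.Tendsto.congr (f₁ := fun _ => (1 : ℂ)) ?_ ?_
        · intro j
          have : (K j : ℂ) ≠ 0 := by exact_mod_cast (hK j).ne'
          simp [this]
        · simp
      · rw [aux_integral_mFourier n hn]
        refine Filter.Tendsto.congr' (f₁ := fun _ => (0 : ℂ)) ?_ tendsto_const_nhds
        filter_upwards [h n hn] with j hj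
        rw [hj, mul_zero]
    | zero => simp
    | add a b _ _ ha hb =>
      have := ha.add hb
      rw [← MeasureTheory.integral_add (hint a) (hint b)] at this
      refine this.congr fun j => ?_
      simp [Finset.sum_add_distrib, mul_add]
    | smul c a _ ha =>
      have := ha.const_mul c
      rw [← MeasureTheory.integral_const_mul] at this
      refine this.congr fun j => ?_
      simp only [ContinuousMap.smul_apply, smul_eq_mul, ← Finset.mul_sum]
      ring
  have hf : f ∈ (Submodule.span ℂ (range (UnitAddTorus.mFourier (d := d)))).topologicalClosure := by
    rw [UnitAddTorus.span_mFourier_closure_eq_top]; trivial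
  rw [← SetLike.mem_coe, Submodule.topologicalClosure_coe, Metric.mem_closure_iff] at hf
  rw [Metric.tendsto_nhds]
  intro e he
  obtain ⟨g, hg, hfg⟩ := hf (e / 3) (by positivity)
  have hpt : ∀ t, ‖f t - g t‖ ≤ e / 3 := fun t => by
    rw [← dist_eq_norm]
    exact (ContinuousMap.dist_apply_le_dist t).trans hfg.le
  filter_upwards [(Metric.tendsto_nhds.1 (hspan g hg)) (e / 3) (by positivity)] with j hj
  have h1 : dist (((K j : ℂ))⁻¹ * ∑ k ∈ Finset.range (K j), f (x j k))
      (((K j : ℂ))⁻¹ * ∑ k ∈ Finset.range (K j), g (x j k)) ≤ e / 3 := by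
    rw [dist_eq_norm, ← mul_sub, ← Finset.sum_sub_distrib, norm_mul, norm_inv, Complex.norm_natCast]
    have hk : (0 : ℝ) < K j := by exact_mod_cast hK j
    rw [inv_mul_le_iff₀ hk]
    refine (norm_sum_le _ _).trans ?_
    refine (Finset.sum_le_sum fun k _ => hpt (x j k)).trans ?_
    simp
  have h2 : dist (∫ t, g t) (∫ t, f t) ≤ e / 3 := by
    rw [dist_comm, dist_eq_norm, ← MeasureTheory.integral_sub (hint f) (hint g)]
    refine (MeasureTheory.norm_integral_le_of_norm_le_const
      (Filter.Eventually.of_forall hpt)).trans ?_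
    simp
  linarith [dist_triangle4 (((K j : ℂ))⁻¹ * ∑ k ∈ Finset.range (K j), f (x j k))
      (((K j : ℂ))⁻¹ * ∑ k ∈ Finset.range (K j), g (x j k)) (∫ t, g t) (∫ t, f t)]

theorem aux_hit {d : Type*} [Fintype d] (K : ℕ → ℕ) (hK : ∀ j, 0 < K j)
    (x : ℕ → ℕ → UnitAddTorus d)
    (h : ∀ n : d → ℤ, n ≠ 0 → ∀ᶠ j in Filter.atTop,
      ∑ k ∈ Finset.range (K j), UnitAddTorus.mFourier n (x j k) = 0)
    (c : UnitAddTorus d) (r : ℝ) (hr : 0 < r) :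
    ∀ᶠ j in Filter.atTop, ∃ k, dist (x j k) c < r := by
  let f0 : UnitAddTorus d → ℝ := fun t => max 0 (r - dist t c)
  have hf0 : Continuous f0 := by fun_prop
  let f : C(UnitAddTorus d, ℂ) := ⟨fun t => (f0 t : ℂ), by fun_prop⟩
  have hpos : 0 < ∫ t, f0 t := by
    refine hf0.integral_pos_of_hasCompactSupport_nonneg_nonzero (x := c)
      (HasCompactSupport.of_compactSpace _) (fun t => le_max_left _ _) ?_
    simp [f0, hr.le, hr.ne']
  have hne : (∫ t, f t) ≠ 0 := by
    have : (∫ t, f t) = ((∫ t, f0 t : ℝ) : ℂ) := integral_ofReal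
    rw [this]
    exact_mod_cast hpos.ne'
  filter_upwards [(aux_weyl K hK x h f).eventually_ne hne] with j hj
  by_contra hcon
  push Not at hcon
  apply hj
  rw [Finset.sum_eq_zero, mul_zero]
  intro k _
  have := hcon k
  have : f0 (x j k) = 0 := max_eq_left (by linarith)
  change ((f0 (x j k) : ℝ) : ℂ) = 0
  rw [this]; simp

theorem aux_char_sum {d : Type*} [Fintype d] (n : d → ℤ) (w : d → ℕ) (Q : ℕ) (hQ : 0 < Q)
    (h : ¬ (Q : ℤ) ∣ ∑ i, n i * w i) :
    ∑ k ∈ Finset.range Q, UnitAddTorus.mFourier n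
      (fun i => (((k : ℝ) * w i / Q : ℝ) : UnitAddCircle)) = 0 := by
  set s : ℤ := ∑ i, n i * w i with hs
  have hQ0 : (Q : ℂ) ≠ 0 := by exact_mod_cast hQ.ne'
  set z : ℂ := Complex.exp (2 * Real.pi * Complex.I * (s / Q)) with hz
  have hterm : ∀ k : ℕ, UnitAddTorus.mFourier n
      (fun i => (((k : ℝ) * w i / Q : ℝ) : UnitAddCircle)) = z ^ k := by
    intro k
    simp only [UnitAddTorus.mFourier, ContinuousMap.coe_mk]
    simp_rw [fourier_coe_apply]
    rw [← Complex.exp_sum, hz, ← Complex.exp_nat_mul]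
    congr 1
    rw [hs]
    push_cast
    rw [Finset.sum_div, Finset.mul_sum, Finset.mul_sum]
    refine Finset.sum_congr rfl fun i _ => ?_
    field_simp
  simp_rw [hterm]
  have hz1 : z ≠ 1 := by
    intro h1
    rw [hz, Complex.exp_eq_one_iff] at h1
    obtain ⟨t, ht⟩ := h1
    apply h
    refine ⟨t, ?_⟩
    have h2 : (2 * Real.pi * Complex.I : ℂ) ≠ 0 := Complex.two_pi_I_ne_zero
    have : (s / Q : ℂ) = t := by
      apply mul_left_cancel₀ h2
      rw [ht]; ring
    rw [div_eq_iff hQ0] at this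
    have h3 : (s : ℂ) = ((Q * t : ℤ) : ℂ) := by push_cast; rw [this]; ring
    exact_mod_cast h3
  have hzQ : z ^ Q = 1 := by
    rw [hz, ← Complex.exp_nat_mul, Complex.exp_eq_one_iff]
    exact ⟨s, by field_simp⟩
  rw [geom_sum_eq hz1, hzQ]; simp

theorem aux_rel {ι : Type*} [Fintype ι] [DecidableEq ι] (A D g : ι → ℤ) (b : ℤ)
    (hA : ∀ i j, i ≠ j → D j ∣ A i - 1) (hAD : ∀ j, D j ∣ A j)
    (hb : ∀ j, |∑ i, g i - g j - b| < D j) (hA1 : ∀ i, 1 < A i)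
    (heq : ∑ i, g i * A i = b) : (∀ i, g i = 0) ∧ b = 0 := by
  have key : ∀ j, ∑ i, g i - g j - b = 0 := by
    intro j
    apply Int.eq_zero_of_abs_lt_dvd (m := D j) _ (hb j)
    have h1 : ∑ i, g i - g j - b = g j * (A j - 1) - ∑ i, g i * (A i - 1) - 0 + (0 - g j * A j)
        := by
      simp only [mul_sub, Finset.sum_sub_distrib, heq, mul_one]
      ring
    rw [← Finset.add_sum_erase Finset.univ (fun i => g i * (A i - 1)) (Finset.mem_univ j)] at h1
    have h2 : ∑ i, g i - g j - b =
        - (∑ i ∈ Finset.univ.erase j, g i * (A i - 1)) - g j * A j := by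
      rw [h1]; ring
    rw [h2]
    refine dvd_sub ((dvd_neg).2 (Finset.dvd_sum fun i hi => ?_)) (Dvd.dvd.mul_left (hAD j) _)
    exact Dvd.dvd.mul_left (hA i j (Finset.ne_of_mem_erase hi)) _
  have hg : ∀ i, g i = 0 := by
    intro j
    set G := g j with hG
    have hall : ∀ i, g i = G := fun i => by linarith [key i, key j]
    have h3 : ∑ i, g i = Fintype.card ι * G := by
      simp [hall]
    have h4 : G * ∑ i, A i = b := by
      rw [← heq, Finset.mul_sum]
      exact Finset.sum_congr rfl fun i _ => by rw [hall]
    have h5 : (Fintype.card ι : ℤ) < ∑ i, A i := by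
      have : ∑ i : ι, (1 : ℤ) < ∑ i, A i :=
        Finset.sum_lt_sum_of_nonempty ⟨j, Finset.mem_univ j⟩ fun i _ => hA1 i
      simpa using this
    have h6 := key j
    have h7 : G * (∑ i, A i - Fintype.card ι + 1) = 0 := by
      rw [h3] at h6
      linear_combination h4 - h6
    rcases mul_eq_zero.1 h7 with h | h
    · exact h
    · linarith
  exact ⟨hg, by rw [← heq]; simp [hg]⟩

theorem aux_dirichlet {ι : Type*} [Fintype ι] (a : ι → ℝ) (e : ℝ) (he : 0 < e) :
    ∃ m : ℕ, 1 ≤ m ∧ ∃ c : ι → ℤ, ∀ i, |m * a i - c i| < e := by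
  let u : ℕ → (ι → UnitAddCircle) := fun m i => (((m : ℝ) * a i : ℝ) : UnitAddCircle)
  obtain ⟨l, φ, hφ, hl⟩ := CompactSpace.tendsto_subseq u
  obtain ⟨N, hN⟩ := Metric.cauchySeq_iff'.1 hl.cauchySeq e he
  have h1 := hN (N + 1) (Nat.le_succ N)
  have hlt : φ N < φ (N + 1) := hφ (Nat.lt_succ_self N)
  rw [dist_pi_lt_iff he] at h1
  refine ⟨φ (N + 1) - φ N, by omega,
    fun i => round (((φ (N + 1) - φ N : ℕ) : ℝ) * a i), fun i => ?_⟩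
  have h2 := h1 i
  simp only [Function.comp, u] at h2
  rw [dist_eq_norm, ← AddCircle.coe_sub, UnitAddCircle.norm_eq, ← sub_mul,
    ← Nat.cast_sub hlt.le] at h2
  exact h2

theorem aux_exps {ι : Type*} [Fintype ι] (p : ι → ℕ) (hp : ∀ i, 2 ≤ p i) (T : ℕ) (hT : 1 ≤ T)
    (e : ℝ) (he : 0 < e) :
    ∃ n : ι → ℕ, (∀ i, T ∣ n i ∧ 0 < n i) ∧
      ∀ i j, |n i * Real.log (p i) - n j * Real.log (p j)| < e := by
  have hlog : ∀ i, 0 < Real.log (p i) := fun i =>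
    Real.log_pos (by exact_mod_cast (hp i))
  set S : ℝ := 1 + ∑ i, Real.log (p i) with hS
  have hSi : ∀ i, Real.log (p i) ≤ S := fun i => by
    have := Finset.single_le_sum (f := fun i => Real.log (p i)) (fun i _ => (hlog i).le)
      (Finset.mem_univ i)
    linarith
  have hSpos : 0 < S := by
    have : 0 ≤ ∑ i, Real.log (p i) := Finset.sum_nonneg fun i _ => (hlog i).le
    linarith
  set e' := min (e / 2) 1 with he'
  have he'0 : 0 < e' := by positivity
  have hT' : (1 : ℝ) ≤ T := by exact_mod_cast hT
  obtain ⟨m, hm, c, hc⟩ := aux_dirichlet (fun i => 1 / Real.log (p i)) (e' / (T * S))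
    (by positivity)
  have hm' : (1 : ℝ) ≤ m := by exact_mod_cast hm
  have key : ∀ i, |(m : ℝ) * T - (c i * T) * Real.log (p i)| < e' := by
    intro i
    have h1 := hc i
    have h2 : (m : ℝ) * T - (c i * T) * Real.log (p i)
        = (T * Real.log (p i)) * (m * (1 / Real.log (p i)) - c i) := by
      have := (hlog i).ne'
      field_simp
    have h0 : (0 : ℝ) < T * Real.log (p i) := mul_pos (by linarith) (hlog i)
    rw [h2, abs_mul, abs_of_pos h0]
    calc T * Real.log (p i) * |m * (1 / Real.log (p i)) - c i|
        < T * Real.log (p i) * (e' / (T * S)) := by gcongr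
      _ ≤ T * S * (e' / (T * S)) := by gcongr; exact hSi i
      _ = e' := by field_simp
  have hcpos : ∀ i, 0 < c i := by
    intro i
    by_contra hcon
    push Not at hcon
    have h1 := (abs_lt.1 (key i)).2
    have h2 : ((c i : ℝ) * T) * Real.log (p i) ≤ 0 := by
      have : (c i : ℝ) ≤ 0 := by exact_mod_cast hcon
      exact mul_nonpos_of_nonpos_of_nonneg
        (mul_nonpos_of_nonpos_of_nonneg this (by linarith)) (hlog i).le
    have h3 : e' ≤ 1 := min_le_right _ _
    nlinarith
  have hcast : ∀ i, (((c i).toNat * T : ℕ) : ℝ) = c i * T := by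
    intro i
    have : (((c i).toNat : ℤ) : ℝ) = c i := by rw [Int.toNat_of_nonneg (hcpos i).le]
    push_cast
    rw [← this, Int.cast_natCast]
  refine ⟨fun i => (c i).toNat * T, fun i => ⟨Dvd.intro_left _ rfl, ?_⟩, fun i j => ?_⟩
  · have := hcpos i
    have : 0 < (c i).toNat := by omega
    positivity
  · rw [hcast, hcast]
    have h1 := abs_lt.1 (key i)
    have h2 := abs_lt.1 (key j)
    have h3 : e' ≤ e / 2 := min_le_left _ _
    rw [abs_lt]
    constructor <;> linarith

theorem aux_ratio {a b n m : ℕ} (ha : 2 ≤ a) (hb : 2 ≤ b) (e : ℝ) (he : e ≤ 1)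
    (h : |n * Real.log a - m * Real.log b| < e) :
    |(a : ℝ) ^ n / (b : ℝ) ^ m - 1| ≤ 2 * e := by
  have h1 : (a : ℝ) ^ n / (b : ℝ) ^ m = Real.exp (n * Real.log a - m * Real.log b) := by
    have ha' : (0 : ℝ) < a := by positivity
    have hb' : (0 : ℝ) < b := by positivity
    rw [Real.exp_sub, Real.exp_nat_mul, Real.exp_nat_mul, Real.exp_log ha', Real.exp_log hb']
  rw [h1]
  have := Real.abs_exp_sub_one_le (x := n * Real.log a - m * Real.log b) (by linarith)
  linarith

theorem aux_smallest (p : ℕ) (hp : 2 ≤ p) (e k : ℤ) (a b : ℝ)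
    (hsub : Ico a b ⊆ adicInterval p e k) (h1 : a < Upt p e k) (h2 : Upt p e k < b) :
    IsSmallestAdicContaining p e k (Ico a b) := by
  refine ⟨hsub, fun m' k' h => ?_⟩
  have hp0 : (0 : ℝ) < p := by positivity
  have hab : a < b := h1.trans h2
  unfold adicInterval at *
  obtain ⟨hu, hv⟩ := (Ico_subset_Ico_iff hab).1 h
  obtain ⟨hu', hv'⟩ := (Ico_subset_Ico_iff hab).1 hsub
  have hm0 : (0 : ℝ) < (p : ℝ) ^ m' := by positivity
  have he0 : (0 : ℝ) < (p : ℝ) ^ e := by positivity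
  rcases le_or_gt m' e with hme | hme
  · obtain ⟨d, hd⟩ := Int.eq_ofNat_of_zero_le (sub_nonneg.2 hme)
    have hpe : (p : ℝ) ^ e = (p : ℝ) ^ m' * (p : ℝ) ^ d := by
      rw [← zpow_natCast, ← zpow_add₀ hp0.ne', ← hd]; congr 1; ring
    have hd0 : (0 : ℝ) < (p : ℝ) ^ d := by positivity
    have e1 : ((k' : ℝ) - 1) / (p : ℝ) ^ m' = (((k' - 1) * p ^ d : ℤ) : ℝ) / (p : ℝ) ^ e := by
      rw [hpe]; push_cast; field_simp
    have e2 : (k' : ℝ) / (p : ℝ) ^ m' = ((k' * p ^ d : ℤ) : ℝ) / (p : ℝ) ^ e := by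
      rw [hpe]; push_cast; field_simp
    rw [e1] at hu ⊢
    rw [e2] at hv ⊢
    have f1 : (((k' - 1) * p ^ d : ℤ) : ℝ) < k :=
      (div_lt_div_iff_of_pos_right he0).1 (by linarith)
    have f2 : (k : ℝ) - 1 < ((k' * p ^ d : ℤ) : ℝ) :=
      (div_lt_div_iff_of_pos_right he0).1 (by linarith)
    have g1 : (k' - 1) * p ^ d < k := by exact_mod_cast f1
    have g2 : k - 1 < k' * p ^ d := by exact_mod_cast f2
    apply Ico_subset_Ico
    · gcongr
      have : (k' - 1) * p ^ d ≤ k - 1 := by linarith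
      exact_mod_cast this
    · gcongr
      have : k ≤ k' * p ^ d := by linarith
      exact_mod_cast this
  · exfalso
    obtain ⟨d, hd⟩ := Int.eq_ofNat_of_zero_le (sub_nonneg.2 (Int.add_one_le_iff.2 hme))
    have hpe : (p : ℝ) ^ m' = (p : ℝ) ^ e * p * (p : ℝ) ^ d := by
      rw [← zpow_natCast, ← zpow_add_one₀ hp0.ne', ← zpow_add₀ hp0.ne', ← hd]; congr 1; ring
    have hd0 : (0 : ℝ) < (p : ℝ) ^ d := by positivity
    have hU : Upt p e k = ((((k - 1) * p + 1) * p ^ d : ℤ) : ℝ) / (p : ℝ) ^ m' := by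
      unfold Upt
      rw [hpe, zpow_add_one₀ hp0.ne']; push_cast; field_simp
    rw [hU] at h1 h2
    have f1 : (k' : ℝ) - 1 < ((((k - 1) * p + 1) * p ^ d : ℤ) : ℝ) :=
      (div_lt_div_iff_of_pos_right hm0).1 (by linarith)
    have f2 : ((((k - 1) * p + 1) * p ^ d : ℤ) : ℝ) < k' :=
      (div_lt_div_iff_of_pos_right hm0).1 (by linarith)
    have g1 : k' - 1 < ((k - 1) * p + 1) * p ^ d := by exact_mod_cast f1
    have g2 : ((k - 1) * p + 1) * p ^ d < k' := by exact_mod_cast f2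
    omega

set_option maxHeartbeats 1000000 in
/-- The local verification for one prime. -/
theorem aux_local (q p N e : ℕ) (hq : 2 ≤ q) (hp : 2 ≤ p) (k z : ℤ) (ε u w : ℝ)
    (hε : 0 < ε) (hεq : ε ≤ 1 / (2 * q))
    (hu : |u| ≤ ε / 8) (hw : |w| < ε / (8 * p ^ 2))
    (hrat : (p : ℝ) ^ e / (q : ℝ) ^ N = (1 + u) / p ^ 2)
    (hk : (k : ℝ) * ((p : ℝ) ^ e / (q : ℝ) ^ N)
      = z + (1 / p + 1 / (p ^ 2 * q) - ε / (2 * p ^ 2)) + w) :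
    ∃ mJ kJ : ℤ, IsSmallestAdicContaining p mJ kJ (adicInterval q N k) ∧
      0 < Upt p mJ kJ - Zpt q N k ∧
      Upt p mJ kJ - Zpt q N k ≤ ε * (q : ℝ) ^ (-(N : ℤ)) := by
  have hq2 : (2 : ℝ) ≤ q := by exact_mod_cast hq
  have hp2 : (2 : ℝ) ≤ p := by exact_mod_cast hp
  have hq0 : (0 : ℝ) < q := by linarith
  have hp0 : (0 : ℝ) < p := by linarith
  obtain ⟨hu1, hu2⟩ := abs_le.1 hu
  obtain ⟨hw1, hw2⟩ := abs_lt.1 hw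
  have hε4 : ε ≤ 1 / 4 := hεq.trans (by
    rw [div_le_div_iff₀ (by positivity) (by positivity)]; linarith)
  set Q : ℝ := (q : ℝ) ^ N with hQ
  set R : ℝ := (p : ℝ) ^ e with hR
  have hQ0 : 0 < Q := by positivity
  have hR0 : 0 < R := by positivity
  have hRQ : R = Q * ((1 + u) / p ^ 2) := by
    rw [← hrat]; field_simp
  have hUform : Upt p e (z + 1) = (z + 1 / p) / R := by
    unfold Upt
    rw [zpow_add_one₀ hp0.ne', zpow_natCast]; push_cast; field_simp; ring
  have hZform : Zpt q N k = (k - 1 / q) / Q := by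
    unfold Zpt
    rw [zpow_add_one₀ hq0.ne', zpow_natCast]; field_simp; ring
  -- the scaled difference
  set v : ℝ := z + 1 / p - k * (R / Q) + R / Q / q with hv
  have hdiff : Upt p e (z + 1) - Zpt q N k = v / R := by
    rw [hUform, hZform, hv]; field_simp; ring
  have hvv : v * p ^ 2 = ε / 2 + u / q - w * p ^ 2 := by
    rw [hv, hk, hrat]; field_simp; ring
  have hwp1 : w * p ^ 2 < ε / 8 := by
    rw [lt_div_iff₀ (by positivity)] at hw2; linarith
  have hwp2 : -(ε / 8) < w * p ^ 2 := by
    rw [← neg_div, div_lt_iff₀ (by positivity)] at hw1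
    linarith
  have huq : |u / q| ≤ ε / 16 := by
    rw [abs_div, abs_of_pos hq0, div_le_iff₀ hq0]
    nlinarith
  obtain ⟨huq1, huq2⟩ := abs_le.1 huq
  have hv0 : 0 < v := by
    have : 0 < v * p ^ 2 := by rw [hvv]; linarith
    exact pos_of_mul_pos_left this (by positivity)
  have hvle : v ≤ ε * ((1 + u) / p ^ 2) := by
    rw [← mul_div_assoc, le_div_iff₀ (by positivity), hvv]
    nlinarith
  have hd0 : 0 < Upt p e (z + 1) - Zpt q N k := by rw [hdiff]; positivity
  have hdle : Upt p e (z + 1) - Zpt q N k ≤ ε / Q := by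
    rw [hdiff, div_le_div_iff₀ hR0 hQ0, hRQ]
    calc v * Q ≤ ε * ((1 + u) / p ^ 2) * Q := mul_le_mul_of_nonneg_right hvle hQ0.le
      _ = ε * (Q * ((1 + u) / p ^ 2)) := by ring
  -- size comparison
  have hpR : p * R ≤ Q := by
    rw [hRQ]
    have : (p : ℝ) * (Q * ((1 + u) / p ^ 2)) = Q * ((1 + u) / p) := by field_simp
    rw [this]
    have : (1 + u) / p ≤ 1 := by rw [div_le_one hp0]; linarith
    exact mul_le_of_le_one_right hQ0.le this
  have hinv : 1 / Q ≤ 1 / (p * R) := one_div_le_one_div_of_le (by positivity) hpR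
  have hεq' : ε / Q ≤ 1 / (2 * q) / Q := by gcongr
  have hlt : 1 / (2 * q) / Q < 1 / q / Q := by
    gcongr; linarith
  have hI : adicInterval q N k = Ico (((k : ℝ) - 1) / Q) (k / Q) := by
    unfold adicInterval; rw [zpow_natCast]
  have eZ : Zpt q N k = k / Q - 1 / q / Q := by rw [hZform, sub_div]
  have eI : ((k : ℝ) - 1) / Q = k / Q - 1 / Q := by rw [sub_div]
  have hq1 : 1 / q / Q ≤ 1 / Q := by
    gcongr; rw [div_le_one hq0]; linarith
  refine ⟨e, z + 1, ?_, hd0, ?_⟩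
  · rw [hI]
    apply aux_smallest p hp
    · unfold adicInterval
      rw [zpow_natCast]
      have e1 : ((z + 1 : ℤ) - 1 : ℝ) / R = Upt p e (z + 1) - 1 / (p * R) := by
        rw [hUform]; push_cast; field_simp; ring
      have e2 : ((z + 1 : ℤ) : ℝ) / R = Upt p e (z + 1) - 1 / (p * R) + p * (1 / (p * R)) := by
        rw [hUform]; push_cast; field_simp; ring
      apply Ico_subset_Ico
      · rw [← hR, e1, eI]; linarith
      · rw [← hR, e2]
        have : 0 < 1 / (p * R) := by positivity
        nlinarith
    · rw [eI]; linarith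
    · linarith
  · rw [zpow_neg, zpow_natCast, ← div_eq_mul_inv]
    exact hdle

/-- The common divisor imposed on all exponents at stage `j`. -/
def auxT {ι : Type*} [Fintype ι] (P : ι → ℕ) (j : ℕ) : ℕ :=
  (j + 2) * ∏ l, Nat.totient (P l ^ j)

theorem auxT_pos {ι : Type*} [Fintype ι] (P : ι → ℕ) (hP : ∀ i, (P i).Prime) (j : ℕ) :
    0 < auxT P j := by
  unfold auxT
  have : 0 < ∏ l, Nat.totient (P l ^ j) :=
    Finset.prod_pos fun l _ => Nat.totient_pos.2 (pow_pos (hP l).pos j)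
  positivity

theorem aux_norel (M : ℕ) (P : Fin (M + 1) → ℕ) (hP : ∀ i, (P i).Prime)
    (hinj : Function.Injective P) (n : ℕ → Fin (M + 1) → ℕ)
    (hT : ∀ j i, auxT P j ∣ n j i) (hn : ∀ j i, j + 2 ≤ n j i)
    (hw : ∀ j i, P i ^ (n j i - 2) ≤ P 0 ^ n j 0)
    (h : Fin (M + 1) → ℤ) (hh : h ≠ 0) :
    ∀ᶠ j in Filter.atTop, ¬ ((P 0 ^ n j 0 : ℕ) : ℤ) ∣
      ∑ i, h i * ((if i = 0 then 1 else P i ^ (n j i - 2) : ℕ) : ℤ) := by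
  set C : ℤ := ∑ i, |h i| with hC
  have hC0 : 0 ≤ C := Finset.sum_nonneg fun i _ => abs_nonneg _
  have hCi : ∀ i, |h i| ≤ C := fun i =>
    Finset.single_le_sum (f := fun i => |h i|) (fun i _ => abs_nonneg _) (Finset.mem_univ i)
  set R : ℤ := ∏ i, (P i : ℤ) ^ 2 with hR
  have hPpos : ∀ i, (0 : ℤ) < P i := fun i => by exact_mod_cast (hP i).pos
  have hR0 : 0 < R := Finset.prod_pos fun i _ => pow_pos (hPpos i) 2
  have hRi : ∀ i, ∃ r : ℤ, R = P i ^ 2 * r ∧ 0 < r ∧ r ≤ R := by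
    intro i
    obtain ⟨r, hr⟩ := Finset.dvd_prod_of_mem (fun i => (P i : ℤ) ^ 2) (Finset.mem_univ i)
    have h2 : (0 : ℤ) < P i ^ 2 := pow_pos (hPpos i) 2
    have hr' : R = P i ^ 2 * r := hr
    have hr0 : 0 < r := by
      rw [hr'] at hR0
      exact pos_of_mul_pos_right hR0 h2.le
    exact ⟨r, hr', hr0, by rw [hr']; nlinarith⟩
  choose r hr hr0 hrR using hRi
  filter_upwards [Filter.eventually_ge_atTop (((M + 3) * (C * R)).toNat)] with j hj hdvd
  obtain ⟨z, hz⟩ := hdvd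
  set Q : ℤ := ((P 0 ^ n j 0 : ℕ) : ℤ) with hQ
  have hQ0 : 0 < Q := by rw [hQ]; exact_mod_cast pow_pos (hP 0).pos _
  -- bound on z
  have hzC : |z| ≤ C := by
    have h1 : |Q * z| ≤ C * Q := by
      rw [← hz, hC, Finset.sum_mul]
      refine (Finset.abs_sum_le_sum_abs _ _).trans (Finset.sum_le_sum fun i _ => ?_)
      rw [abs_mul]
      refine mul_le_mul_of_nonneg_left ?_ (abs_nonneg _)
      rw [Nat.abs_cast]
      have : (if i = 0 then 1 else P i ^ (n j i - 2)) ≤ P 0 ^ n j 0 := by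
        split_ifs
        · exact Nat.one_le_pow _ _ (hP 0).pos
        · exact hw j i
      rw [hQ]
      exact Nat.cast_le.2 this
    rw [abs_mul, abs_of_pos hQ0, mul_comm] at h1
    exact le_of_mul_le_mul_right h1 hQ0
  let A : Fin (M + 1) → ℤ := fun i => ((P i ^ n j i : ℕ) : ℤ)
  let D : Fin (M + 1) → ℤ := fun i => ((P i ^ j : ℕ) : ℤ)
  let g : Fin (M + 1) → ℤ := fun i => if i = 0 then - z * R else h i * r i
  have hgb : ∀ i, |g i| ≤ C * R := by
    intro i
    simp only [g]
    split_ifs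
    · rw [abs_mul, abs_neg, abs_of_pos hR0]
      exact mul_le_mul_of_nonneg_right hzC hR0.le
    · rw [abs_mul, abs_of_pos (hr0 i)]
      exact mul_le_mul (hCi i) (hrR i) (hr0 i).le hC0
  have hmain := aux_rel A D g (- R * h 0) ?_ ?_ ?_ ?_ ?_
  · obtain ⟨hg, hb⟩ := hmain
    apply hh
    funext i
    by_cases hi : i = 0
    · subst hi
      rcases mul_eq_zero.1 hb with h1 | h1
      · linarith
      · exact h1
    · have := hg i
      simp only [g, hi, if_false] at this
      rcases mul_eq_zero.1 this with h1 | h1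
      · exact h1
      · exact absurd h1 (hr0 i).ne'
  · intro i l hil
    have hcop : Nat.Coprime (P i) (P l ^ j) :=
      Nat.Coprime.pow_right _ ((Nat.coprime_primes (hP i) (hP l)).2 fun h => hil (hinj h))
    have h1 : Nat.totient (P l ^ j) ∣ n j i := by
      refine Dvd.dvd.trans ?_ (hT j i)
      unfold auxT
      exact Dvd.dvd.mul_left
        (Finset.dvd_prod_of_mem (fun l => Nat.totient (P l ^ j)) (Finset.mem_univ l)) _
    obtain ⟨t, ht⟩ := h1
    have h2 : P i ^ n j i ≡ 1 [MOD P l ^ j] := by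
      rw [ht, pow_mul]
      simpa using (Nat.ModEq.pow_totient hcop).pow t
    have h3 := (Nat.modEq_iff_dvd.1 h2.symm)
    simpa [A, D] using h3
  · intro l
    simp only [A, D]
    exact_mod_cast pow_dvd_pow (P l) (by have := hn j l; omega)
  · intro l
    have h1 : |∑ i, g i| ≤ (M + 1) * (C * R) := by
      refine (Finset.abs_sum_le_sum_abs _ _).trans
        ((Finset.sum_le_sum fun i _ => hgb i).trans ?_)
      simp
    have h2 := hgb l
    have h3 : |(- R * h 0)| ≤ C * R := by
      rw [abs_mul, abs_neg, abs_of_pos hR0, mul_comm]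
      exact mul_le_mul_of_nonneg_right (hCi 0) hR0.le
    have h4 : (M + 3) * (C * R) ≤ j := by
      have := Int.self_le_toNat ((M + 3) * (C * R))
      have h5 : ((((M + 3) * (C * R)).toNat : ℕ) : ℤ) ≤ j := by exact_mod_cast hj
      linarith
    have h5 : (j : ℤ) < D l := by
      simp only [D]
      exact_mod_cast Nat.lt_pow_self (hP l).one_lt
    have h6 := abs_le.1 h1
    have h7 := abs_le.1 h2
    have h8 := abs_le.1 h3
    rw [abs_lt]
    constructor <;> nlinarith
  · intro i
    simp only [A]
    have := hn j i
    exact_mod_cast Nat.one_lt_pow (by omega) (hP i).one_lt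
  · have h1 : ∀ i, g i * A i = R * (h i * ((if i = 0 then 1 else P i ^ (n j i - 2) : ℕ) : ℤ))
        - (if i = 0 then R * h 0 + R * (Q * z) else 0) := by
      intro i
      by_cases hi : i = 0
      · subst hi
        simp only [g, A, if_true]
        rw [← hQ]; push_cast; ring
      · simp only [g, A, hi, if_false]
        have h2 : P i ^ n j i = P i ^ 2 * P i ^ (n j i - 2) := by
          rw [← pow_add]; congr 1; have := hn j i; omega
        rw [h2, hr i]; push_cast; ring
    rw [Finset.sum_congr rfl fun i _ => h1 i, Finset.sum_sub_distrib, ← Finset.mul_sum, hz]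
    simp

/-- For distinct primes `P 0 < P i` (`P 0` smallest), every nondegenerate interval
`Jt ⊆ [0,1]` and every `ε > 0`, there is a `P 0`-adic interval `I ⊆ Jt` such that for every
`i ≠ 0`, `0 < Υ(J_i) - Z(I) ≤ ε |I|`, where `J_i` is the smallest `P i`-adic interval
containing `I`. -/
theorem selection_single_interval_many_primes (M : ℕ) (P : Fin (M + 1) → ℕ)
    (hP : ∀ i, (P i).Prime) (hinj : Function.Injective P) (hmin : ∀ i, P 0 ≤ P i)
    (Jt : Set ℝ) (hconn : Jt.OrdConnected) (hsub : Jt ⊆ Set.Icc (0 : ℝ) 1)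
    (x y : ℝ) (hx : x ∈ Jt) (hy : y ∈ Jt) (hxy : x < y)
    (ε : ℝ) (hε : 0 < ε) :
    ∃ mI kI : ℤ, adicInterval (P 0) mI kI ⊆ Jt ∧
      ∀ i : Fin (M + 1), i ≠ 0 →
        ∃ mJ kJ : ℤ,
          IsSmallestAdicContaining (P i) mJ kJ (adicInterval (P 0) mI kI) ∧
          0 < Upt (P i) mJ kJ - Zpt (P 0) mI kI ∧
          Upt (P i) mJ kJ - Zpt (P 0) mI kI ≤ ε * ((P 0 : ℕ) : ℝ) ^ (-mI) := by
  have hP2 : ∀ i, 2 ≤ P i := fun i => (hP i).two_le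
  have hP2' : ∀ i, (2 : ℝ) ≤ P i := fun i => by exact_mod_cast hP2 i
  have hP0 : ∀ i, (0 : ℝ) < P i := fun i => by linarith [hP2' i]
  set δ : ℝ := min ε (1 / (2 * P 0)) with hδ
  have hδ0 : 0 < δ := by
    have := hP0 0
    positivity
  have hδε : δ ≤ ε := min_le_left _ _
  have hδq : δ ≤ 1 / (2 * P 0) := min_le_right _ _
  have hδ1 : δ ≤ 1 := hδq.trans (by
    have := hP2' 0
    rw [div_le_one (by linarith)]; linarith)
  choose n hn1 hn2 using fun j : ℕ => aux_exps P hP2 (auxT P j) (auxT_pos P hP j) (δ / 16)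
    (by positivity)
  have hn : ∀ j i, j + 2 ≤ n j i := by
    intro j i
    refine le_trans ?_ (Nat.le_of_dvd (hn1 j i).2 (hn1 j i).1)
    unfold auxT
    exact Nat.le_mul_of_pos_right _
      (Finset.prod_pos fun l _ => Nat.totient_pos.2 (pow_pos (hP l).pos j))
  have hrat : ∀ j i, |(P i : ℝ) ^ n j i / (P 0 : ℝ) ^ n j 0 - 1| ≤ δ / 8 := by
    intro j i
    have := aux_ratio (hP2 i) (hP2 0) (δ / 16) (by linarith) (hn2 j i 0)
    linarith
  have hsplit : ∀ j i, (P i : ℝ) ^ n j i = P i ^ 2 * P i ^ (n j i - 2) := by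
    intro j i
    rw [← pow_add]; congr 1; have := hn j i; omega
  have hw : ∀ j i, P i ^ (n j i - 2) ≤ P 0 ^ n j 0 := by
    intro j i
    have h1 := (abs_le.1 (hrat j i)).2
    have hQ : (0 : ℝ) < (P 0 : ℝ) ^ n j 0 := pow_pos (hP0 0) _
    have h2 : (P i : ℝ) ^ n j i / (P 0 : ℝ) ^ n j 0 ≤ 2 := by linarith
    rw [div_le_iff₀ hQ, hsplit] at h2
    have h3 : (0 : ℝ) < (P i : ℝ) ^ (n j i - 2) := pow_pos (hP0 i) _
    have h4 : (2 : ℝ) * 2 ≤ (P i : ℝ) ^ 2 := by nlinarith [hP2' i]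
    have h5 : (P i : ℝ) ^ (n j i - 2) ≤ (P 0 : ℝ) ^ n j 0 := by nlinarith
    exact_mod_cast h5
  set R : ℝ := ∏ i, (P i : ℝ) ^ 2 with hR
  have hR0 : 0 < R := Finset.prod_pos fun i _ => pow_pos (hP0 i) 2
  have hRi : ∀ i, (P i : ℝ) ^ 2 ≤ R := by
    intro i
    have h1 : P i ^ 2 ∣ ∏ i, P i ^ 2 :=
      Finset.dvd_prod_of_mem (fun i => P i ^ 2) (Finset.mem_univ i)
    have h2 : P i ^ 2 ≤ ∏ i, P i ^ 2 :=
      Nat.le_of_dvd (Finset.prod_pos fun i _ => pow_pos (hP i).pos 2) h1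
    rw [hR]
    exact_mod_cast h2
  set ρ : ℝ := min ((y - x) / 8) (δ / (8 * R)) with hρ
  have hyx : 0 < y - x := sub_pos.2 hxy
  have hρ0 : 0 < ρ := by positivity
  let c : Fin (M + 1) → ℝ := fun i => if i = 0 then (x + y) / 2 else
    1 / P i + 1 / (P i ^ 2 * P 0) - δ / (2 * P i ^ 2)
  let W : ℕ → Fin (M + 1) → ℕ := fun j i => if i = 0 then 1 else P i ^ (n j i - 2)
  have hhit := aux_hit (fun j => P 0 ^ n j 0) (fun j => pow_pos (hP 0).pos _)
    (fun j k i => (((k : ℝ) * W j i / (P 0 ^ n j 0 : ℕ) : ℝ) : UnitAddCircle))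
    (by
      intro h hh
      filter_upwards [aux_norel M P hP hinj n (fun j i => (hn1 j i).1) hn hw h hh] with j hj
      exact aux_char_sum h (W j) (P 0 ^ n j 0) (pow_pos (hP 0).pos _) hj)
    (fun i => (c i : UnitAddCircle)) ρ hρ0
  obtain ⟨j, ⟨k, hk⟩, hj⟩ := (hhit.and
    (Filter.eventually_ge_atTop ⌈8 / (y - x)⌉₊)).exists
  rw [dist_pi_lt_iff hρ0] at hk
  set N := n j 0 with hN
  set Q : ℝ := (P 0 : ℝ) ^ N with hQ
  have hQ0 : 0 < Q := pow_pos (hP0 0) _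
  have hk' : ∀ i, ∃ z : ℤ, |(k : ℝ) * W j i / Q - c i - z| < ρ := by
    intro i
    have h1 := hk i
    rw [dist_eq_norm, ← AddCircle.coe_sub, UnitAddCircle.norm_eq] at h1
    refine ⟨round ((k : ℝ) * W j i / ((P 0 ^ N : ℕ) : ℝ) - c i), ?_⟩
    rw [hQ, ← Nat.cast_pow]
    exact h1
  choose z hz using hk'
  have hQj : 1 / Q ≤ (y - x) / 8 := by
    have h1 : 8 / (y - x) ≤ j := Nat.ceil_le.1 hj
    have h2 : (j : ℝ) ≤ Q := by
      have h3 : j ≤ P 0 ^ N := by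
        have h4 : N < P 0 ^ N := Nat.lt_pow_self (hP 0).one_lt
        have := hn j 0
        omega
      rw [hQ]
      exact_mod_cast h3
    have h3 : 8 / (y - x) ≤ Q := h1.trans h2
    rw [div_le_iff₀ hyx] at h3
    rw [div_le_iff₀ hQ0]
    linarith
  refine ⟨(N : ℤ), (k : ℤ) - z 0 * (P 0 : ℤ) ^ N, ?_, ?_⟩
  · have h0 := hz 0
    simp only [W, c, if_true, Nat.cast_one, mul_one] at h0
    have hρ1 : ρ ≤ (y - x) / 8 := min_le_left _ _
    obtain ⟨h1, h2⟩ := abs_lt.1 h0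
    refine Subset.trans ?_ (hconn.out hx hy)
    unfold adicInterval
    rw [zpow_natCast, ← hQ]
    push_cast
    rw [← hQ]
    have e1 : ((k : ℝ) - z 0 * Q - 1) / Q = k / Q - z 0 - 1 / Q := by field_simp
    have e2 : ((k : ℝ) - z 0 * Q) / Q = k / Q - z 0 := by field_simp
    rw [e1, e2]
    intro t ht
    exact ⟨by linarith [ht.1], by linarith [ht.2]⟩
  · intro i hi
    have hzi := hz i
    simp only [W, c, hi, if_false] at hzi
    push_cast at hzi
    set E := n j i - 2 with hE
    have hRQ : (P i : ℝ) ^ E / Q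
        = (1 + ((P i : ℝ) ^ n j i / Q - 1)) / P i ^ 2 := by
      rw [hsplit j i]
      have := (hP0 i).ne'
      field_simp
      ring
    obtain ⟨mJ, kJ, hS, hd, hle⟩ := aux_local (P 0) (P i) N E (hP2 0) (hP2 i)
      ((k : ℤ) - z 0 * (P 0 : ℤ) ^ N) (z i - z 0 * (P i : ℤ) ^ E) δ
      ((P i : ℝ) ^ n j i / Q - 1)
      ((k : ℝ) * P i ^ E / Q - (1 / P i + 1 / (P i ^ 2 * P 0) - δ / (2 * P i ^ 2)) - z i)
      hδ0 hδq (hrat j i)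
      (by
        refine hzi.trans_le ((min_le_right _ _).trans ?_)
        have := pow_pos (hP0 i) 2
        have := hRi i
        gcongr) hRQ
      (by
        push_cast
        rw [← hQ]
        field_simp
        ring)
    refine ⟨mJ, kJ, hS, hd, hle.trans ?_⟩
    have : (0 : ℝ) ≤ (P 0 : ℝ) ^ (-(N : ℤ)) := (zpow_pos (hP0 0) _).le
    exact mul_le_mul_of_nonneg_right hδε this
end
end
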